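/- arXiv:math/0202090 — 4 statements merged into one kernel-verified Lean document; each statement's English description precedes it below -/
import Mathlib

section
/- Let w ∈ Σ_n. The map R ↦ γ(R), sending an rc-graph R associated to w to the increasing labeled chain from w to w₀ produced by the greedy sequence, is a bijection from R(w) to Γ(w,w₀), the set of increasing chains in the labeled Bruhat order from w to w₀; moreover x^R · x^{γ(R)} = x^δ for every R ∈ R(w). -/
open MvPolynomial

noncomputable section

/-- The symmetric group `Σ_n` on `{0, …, n-1}` (0-indexed model of `{1, …, n}`). -/
abbrev Perm' (n : ℕ) := Equiv.Perm (Fin n)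

/-- The length `ℓ(w)`: the number of inversions of `w`. -/
def invLength {n : ℕ} (w : Perm' n) : ℕ :=
  (Finset.univ.filter (fun p : Fin n × Fin n => p.1 < p.2 ∧ w p.2 < w p.1)).card

/-- The longest permutation `w₀ = n … 2 1`. -/
def w0 (n : ℕ) : Perm' n := Fin.revPerm

/-- `u ⋖ w` in the Bruhat order: `w = u·(k,l)` where `k < l`, `u k < u l`, and no
position strictly between `k` and `l` has a `u`-value between `u k` and `u l`. -/
def BruhatCover {n : ℕ} (u w : Perm' n) : Prop :=
  ∃ k l : Fin n, k < l ∧ u k < u l ∧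
    (∀ i : Fin n, k < i → i < l → ¬(u k < u i ∧ u i < u l)) ∧
    w = u * Equiv.swap k l

/-- The Bruhat order, generated by its covers. -/
def BruhatLE {n : ℕ} : Perm' n → Perm' n → Prop :=
  Relation.ReflTransGen BruhatCover

/-- `u →^{(k,b)} w` is a labeled cover in the labeled Bruhat order (0-indexed):
`u ⋖ w` with `u⁻¹w = (i,j)`, `i ≤ k < j` and `b = u i`. -/
def IsLabeledCover {n : ℕ} (u w : Perm' n) (k b : ℕ) : Prop :=
  ∃ i j : Fin n, i < j ∧ u i < u j ∧
    (∀ m : Fin n, i < m → m < j → ¬(u i < u m ∧ u m < u j)) ∧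
    w = u * Equiv.swap i j ∧ (i : ℕ) ≤ k ∧ k < (j : ℕ) ∧ b = (u i : ℕ)

/-- Strict lexicographic order on labels `(k,b)`. -/
def lexLt (p q : ℕ × ℕ) : Prop := p.1 < q.1 ∨ (p.1 = q.1 ∧ p.2 < q.2)

/-- A saturated labeled chain of length `m` from `u` to `w` in the labeled Bruhat order. -/
structure LabeledChain (n m : ℕ) (u w : Perm' n) where
  c : Fin (m + 1) → Perm' n
  lab : Fin m → ℕ × ℕ
  c_zero : c 0 = u
  c_last : c (Fin.last m) = w
  step : ∀ i : Fin m, IsLabeledCover (c i.castSucc) (c i.succ) (lab i).1 (lab i).2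

/-- A chain is increasing if its labels strictly increase in lexicographic order. -/
def LabeledChain.Increasing {n m : ℕ} {u w : Perm' n} (γ : LabeledChain n m u w) : Prop :=
  ∀ i j : Fin m, i < j → lexLt (γ.lab i) (γ.lab j)

/-- The type of a chain: `α_k` counts labels with first coordinate `k`. -/
def chainType {n m : ℕ} {u w : Perm' n} (γ : LabeledChain n m u w) : Fin n → ℕ :=
  fun k => (Finset.univ.filter (fun i : Fin m => (γ.lab i).1 = (k : ℕ))).card

/-- `I_α(u,w)`: the number of increasing chains from `u` to `w` of type `α`. -/
def incChainCount (n : ℕ) (u w : Perm' n) (α : Fin n → ℕ) : ℕ :=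
  Nat.card ((m : ℕ) × {γ : LabeledChain n m u w // γ.Increasing ∧ chainType γ = α})

/-- The staircase monomial `x^δ = x₁^{n-1} x₂^{n-2} ⋯ x_{n-1}`. -/
def xDelta (n : ℕ) : MvPolynomial (Fin n) ℤ :=
  ∏ i : Fin n, X i ^ (n - 1 - (i : ℕ))

/-- `S` is the family of Schubert polynomials: `S w₀ = x^δ` and
`S w - s_i·(S w) = (x_i - x_{i+1}) · S (w s_i)` whenever `ℓ(w s_i) < ℓ(w)`. -/
def IsSchubertFamily (n : ℕ) (S : Perm' n → MvPolynomial (Fin n) ℤ) : Prop :=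
  S (w0 n) = xDelta n ∧
  ∀ (w : Perm' n) (i : ℕ) (h : i + 1 < n),
    invLength (w * Equiv.swap (⟨i, by omega⟩ : Fin n) ⟨i + 1, h⟩) < invLength w →
    S w - rename (Equiv.swap (⟨i, by omega⟩ : Fin n) ⟨i + 1, h⟩) (S w) =
      (X (⟨i, by omega⟩ : Fin n) - X ⟨i + 1, h⟩) *
        S (w * Equiv.swap (⟨i, by omega⟩ : Fin n) ⟨i + 1, h⟩)

/-- The ideal generated by the elementary symmetric polynomials `e₁, …, e_n`. -/
def symIdeal (n : ℕ) : Ideal (MvPolynomial (Fin n) ℤ) :=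
  Ideal.span ((fun k => esymm (Fin n) ℤ k) '' Set.Icc 1 n)

/-- `g` is the normal form of `f` modulo the ideal of elementary symmetric polynomials :
`f ≡ g` and every monomial of `g` divides `x^δ`.  (For the degree reverse lexicographic
term order with `x₁ < ⋯ < x_n`, the normal form is exactly the unique such `g`.) -/
def IsNormalForm (n : ℕ) (f g : MvPolynomial (Fin n) ℤ) : Prop :=
  f - g ∈ symIdeal n ∧ ∀ d ∈ g.support, ∀ i : Fin n, d i ≤ n - 1 - (i : ℕ)

def finSubEquiv {n N : ℕ} (h : n ≤ N) : Fin n ≃ {i : Fin N // (i : ℕ) < n} where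
  toFun i := ⟨Fin.castLE h i, i.isLt⟩
  invFun j := ⟨(j.1 : ℕ), j.2⟩
  left_inv i := rfl
  right_inv j := rfl

/-- The standard inclusion `Σ_n ⊂ Σ_N`, extending a permutation by fixed points. -/
def permIncl {n N : ℕ} (h : n ≤ N) (u : Perm' n) : Perm' N :=
  u.extendDomain (finSubEquiv h)

/-- `δ` as an exponent vector. -/
def deltaF (n : ℕ) : Fin n →₀ ℕ :=
  Finsupp.equivFunOnFinite.symm fun i => n - 1 - (i : ℕ)

/-- The type of a chain as an exponent vector. -/
def chainTypeF {n m : ℕ} {u w : Perm' n} (γ : LabeledChain n m u w) : Fin n →₀ ℕ :=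
  Finsupp.equivFunOnFinite.symm (chainType γ)

/-- `δ` as an integral exponent vector. -/
def deltaZ (n : ℕ) : Fin n →₀ ℤ :=
  Finsupp.equivFunOnFinite.symm fun i => ((n - 1 - (i : ℕ) : ℕ) : ℤ)

/-- The type of a chain as an integral exponent vector. -/
def chainTypeZ {n m : ℕ} {u w : Perm' n} (γ : LabeledChain n m u w) : Fin n →₀ ℤ :=
  Finsupp.equivFunOnFinite.symm fun k => ((chainType γ k : ℕ) : ℤ)

/-- The inclusion of polynomials into Laurent polynomials. -/
def toLaurent (n : ℕ) : MvPolynomial (Fin n) ℤ →+* AddMonoidAlgebra ℤ (Fin n →₀ ℤ) :=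
  AddMonoidAlgebra.mapDomainRingHom ℤ (Finsupp.mapRange.addMonoidHom (Nat.castAddMonoidHom ℤ))

/-- The complete homogeneous symmetric polynomial `h_a(x₁, …, x_k)` inside
`ℤ[x₁, …, x_n]` (variables are 0-indexed, so the first `k` variables are used). -/
def hpoly (n k a : ℕ) : MvPolynomial (Fin n) ℤ :=
  ∑ s ∈ (Finset.univ.filter (fun i : Fin n => (i : ℕ) < k)).sym a,
    ((s : Multiset (Fin n)).map X).prod

/-- `h_α = h_{α₁}(x₁) h_{α₂}(x₁,x₂) ⋯ h_{α_{n-1}}(x₁, …, x_{n-1})` (0-indexed `α`). -/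
def hAlpha (n : ℕ) (α : Fin n → ℕ) : MvPolynomial (Fin n) ℤ :=
  ∏ i : Fin n, hpoly n ((i : ℕ) + 1) (α i)

/- ## rc-graphs (0-indexed pairs: the paper's pair `(k,b)` is `(k-1, b-1)`) -/

/-- The linear order on rc-graph positions: `(k,b) ≤ (j,a)  ⇔  k < j, or k = j and b ≥ a`. -/
def rcLE (p q : ℕ × ℕ) : Prop := p.1 < q.1 ∨ (p.1 = q.1 ∧ q.2 ≤ p.2)

instance : DecidableRel rcLE := fun p q => by unfold rcLE; exact inferInstance
instance : IsTrans (ℕ × ℕ) rcLE :=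
  ⟨fun a b c h1 h2 => by unfold rcLE at h1 h2 ⊢; omega⟩
instance : IsAntisymm (ℕ × ℕ) rcLE :=
  ⟨fun a b h1 h2 => by unfold rcLE at h1 h2; rw [Prod.ext_iff]; omega⟩
instance : IsTotal (ℕ × ℕ) rcLE := ⟨fun a b => by unfold rcLE; omega⟩

/-- The adjacent transposition `s_{i+1} = (i, i+1)` (0-indexed positions). -/
def adjT (n : ℕ) (i : ℕ) : Perm' n :=
  if h : i + 1 < n then Equiv.swap ⟨i, by omega⟩ ⟨i + 1, h⟩ else 1

/-- The word `d(R)` of a set of positions: list its elements in the order `rcLE` and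
record `k + b` for each pair (0-indexed version of `k + b - 1`). -/
def rcWord (R : Finset (ℕ × ℕ)) : List ℕ :=
  (R.sort rcLE).map (fun p => p.1 + p.2)

/-- The permutation given by a word in the adjacent transpositions. -/
def wordPerm (n : ℕ) (l : List ℕ) : Perm' n :=
  (l.map (adjT n)).prod

/-- The permutation of a set of rc-positions. -/
def rcPerm (n : ℕ) (R : Finset (ℕ × ℕ)) : Perm' n := wordPerm n (rcWord R)

/-- `R` consists of valid rc-positions: (0-indexed) `k + b + 2 ≤ n`. -/
def IsRC (n : ℕ) (R : Finset (ℕ × ℕ)) : Prop := ∀ p ∈ R, p.1 + p.2 + 2 ≤ n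

/-- `R ∈ 𝓡(w)`: `R` is an rc-graph associated to `w`, i.e. `d(R)` is a reduced word for `w`. -/
def AssocRC (n : ℕ) (R : Finset (ℕ × ℕ)) (w : Perm' n) : Prop :=
  IsRC n R ∧ rcPerm n R = w ∧ R.card = invLength w

/-- All valid rc-positions for `Σ_n`. -/
def fullRC (n : ℕ) : Finset (ℕ × ℕ) :=
  (Finset.range n ×ˢ Finset.range n).filter (fun p => p.1 + p.2 + 2 ≤ n)

/-- One greedy step: adjoin the lexicographically smallest valid pair not in `R`. -/
def GreedyStep (n : ℕ) (R R' : Finset (ℕ × ℕ)) : Prop :=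
  ∃ p : ℕ × ℕ, p ∉ R ∧ p.1 + p.2 + 2 ≤ n ∧
    (∀ q : ℕ × ℕ, q.1 + q.2 + 2 ≤ n → q ∉ R → (p.1 < q.1 ∨ (p.1 = q.1 ∧ p.2 ≤ q.2))) ∧
    R' = insert p R

/-- The exponent of `x_i` in `x^R`. -/
def rcType (n : ℕ) (R : Finset (ℕ × ℕ)) : Fin n → ℕ :=
  fun i => (R.filter (fun p => p.1 = (i : ℕ))).card

/-- `γ = γ(R)`: the chain `γ` is produced from `R` by the greedy sequence. -/
def GreedyRel (n : ℕ) {m : ℕ} (w : Perm' n) (R : Finset (ℕ × ℕ))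
    (γ : LabeledChain n m w (w0 n)) : Prop :=
  ∃ Rs : ℕ → Finset (ℕ × ℕ), Rs 0 = R ∧
    (∀ i < m, GreedyStep n (Rs i) (Rs (i + 1))) ∧
    (∀ i : Fin m, γ.lab i ∉ Rs (i : ℕ) ∧ Rs ((i : ℕ) + 1) = insert (γ.lab i) (Rs (i : ℕ))) ∧
    (∀ i : Fin (m + 1), rcPerm n (Rs (i : ℕ)) = γ.c i)

/-! ### Lengths of permutations -/

/-- The length formula for right multiplication by a transposition. -/
theorem invLength_mul_swap {n : ℕ} (u : Perm' n) {i j : Fin n} (hij : i < j) (hu : u i < u j) :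
    invLength (u * Equiv.swap i j) = invLength u + 1 +
      2 * (Finset.univ.filter fun a => (i < a ∧ a < j) ∧ u i < u a ∧ u a < u j).card := by
  have decomp : ∀ f : Fin n → Fin n → ℕ, ∑ p, ∑ q, f p q =
      (∑ p ∈ {i, j}ᶜ, ∑ q ∈ {i, j}ᶜ, f p q) +
        (∑ a ∈ {i, j}ᶜ, (f a i + f a j + f i a + f j a)) + (f i i + f i j + f j i + f j j) := by
    intro f
    have split : ∀ g : Fin n → ℕ, ∑ p, g p = g i + g j + ∑ p ∈ {i, j}ᶜ, g p := fun g => by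
      rw [← Finset.sum_add_sum_compl {i, j} g, Finset.sum_pair hij.ne]
    simp only [split, Finset.sum_add_distrib]
    ring
  have len : ∀ v : Perm' n,
      invLength v = ∑ p, ∑ q, if p < q ∧ v q < v p then 1 else 0 := fun v => by
    rw [invLength, Finset.card_filter, ← Finset.univ_product_univ, Finset.sum_product]
  have away : ∀ a ∈ ({i, j}ᶜ : Finset (Fin n)), a ≠ i ∧ a ≠ j := fun a ha => by
    simpa using ha
  have fix : ∀ a ∈ ({i, j}ᶜ : Finset (Fin n)), (u * Equiv.swap i j) a = u a := fun a ha => by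
    rw [Equiv.Perm.mul_apply, Equiv.swap_apply_of_ne_of_ne (away a ha).1 (away a ha).2]
  have hi : (u * Equiv.swap i j) i = u j := by simp
  have hj : (u * Equiv.swap i j) j = u i := by simp
  have between : (Finset.univ.filter fun a => (i < a ∧ a < j) ∧ u i < u a ∧ u a < u j).card =
      ∑ a ∈ {i, j}ᶜ, if (i < a ∧ a < j) ∧ u i < u a ∧ u a < u j then 1 else 0 := by
    rw [Finset.card_filter, ← Finset.sum_add_sum_compl {i, j}, Finset.sum_pair hij.ne]
    simp
  rw [len, len, decomp, decomp, between]
  have outer : ∑ p ∈ {i, j}ᶜ, ∑ q ∈ {i, j}ᶜ,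
        (if p < q ∧ (u * Equiv.swap i j) q < (u * Equiv.swap i j) p then 1 else 0) =
      ∑ p ∈ {i, j}ᶜ, ∑ q ∈ {i, j}ᶜ, if p < q ∧ u q < u p then 1 else 0 :=
    Finset.sum_congr rfl fun p hp => Finset.sum_congr rfl fun q hq => by rw [fix p hp, fix q hq]
  rw [outer, hi, hj]
  have corner : ∀ a ∈ ({i, j}ᶜ : Finset (Fin n)),
      ((if a < i ∧ u j < (u * Equiv.swap i j) a then 1 else 0) +
        (if a < j ∧ u i < (u * Equiv.swap i j) a then 1 else 0) +
        (if i < a ∧ (u * Equiv.swap i j) a < u j then 1 else 0) +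
        (if j < a ∧ (u * Equiv.swap i j) a < u i then 1 else 0) : ℕ) =
      ((if a < i ∧ u i < u a then 1 else 0) + (if a < j ∧ u j < u a then 1 else 0) +
        (if i < a ∧ u a < u i then 1 else 0) + (if j < a ∧ u a < u j then 1 else 0)) +
      2 * (if (i < a ∧ a < j) ∧ u i < u a ∧ u a < u j then 1 else 0) := by
    intro a ha
    rw [fix a ha]
    obtain ⟨hai, haj⟩ := away a ha
    have hui : u a ≠ u i := u.injective.ne hai
    have huj : u a ≠ u j := u.injective.ne haj
    simp only [Fin.lt_def, ne_eq, Fin.ext_iff] at *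
    generalize (u a : ℕ) = ya at *
    generalize (u i : ℕ) = yi at *
    generalize (u j : ℕ) = yj at *
    split_ifs <;> omega
  rw [Finset.sum_congr rfl corner, Finset.sum_add_distrib, ← Finset.mul_sum]
  simp only [lt_self_iff_false, false_and, and_false, if_false, hij, hu, hij.not_gt, hu.not_gt,
    true_and, if_true]
  ring

/-- A labeled cover raises the length by one. -/
theorem IsLabeledCover.invLength_eq {n : ℕ} {u w : Perm' n} {k b : ℕ}
    (h : IsLabeledCover u w k b) : invLength w = invLength u + 1 := by
  obtain ⟨i, j, hij, hu, hb, rfl, -⟩ := h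
  rw [invLength_mul_swap u hij hu, Finset.filter_false_of_mem]
  · simp
  · rintro a - ⟨⟨h1, h2⟩, h3⟩
    exact hb a h1 h2 h3

theorem invLength_mul_adjT_le {n : ℕ} (u : Perm' n) (d : ℕ) :
    invLength (u * adjT n d) ≤ invLength u + 1 := by
  unfold adjT
  split_ifs with h
  · have hlt : (⟨d, by omega⟩ : Fin n) < ⟨d + 1, h⟩ := by simp [Fin.lt_def]
    have key : ∀ v : Perm' n, v ⟨d, by omega⟩ < v ⟨d + 1, h⟩ →
        invLength (v * Equiv.swap ⟨d, by omega⟩ ⟨d + 1, h⟩) = invLength v + 1 := fun v hv => by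
      rw [invLength_mul_swap v hlt hv, Finset.filter_false_of_mem]
      · simp
      · rintro a - ⟨⟨h1, h2⟩, -⟩
        simp only [Fin.lt_def] at h1 h2
        omega
    rcases lt_or_gt_of_ne (u.injective.ne hlt.ne) with hu | hu
    · exact (key u hu).le
    · have := key (u * Equiv.swap ⟨d, _⟩ ⟨d + 1, h⟩) (by simpa using hu)
      rw [mul_assoc, Equiv.swap_mul_self, mul_one] at this
      omega
  · simp

theorem invLength_one (n : ℕ) : invLength (1 : Perm' n) = 0 := by
  rw [invLength, Finset.card_eq_zero, Finset.filter_eq_empty_iff]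
  rintro ⟨p, q⟩ - ⟨h1, h2⟩
  exact lt_asymm h1 h2

theorem invLength_wordPerm_le (n : ℕ) (l : List ℕ) : invLength (wordPerm n l) ≤ l.length := by
  induction l using List.reverseRecOn with
  | nil => simp [wordPerm, invLength_one]
  | append_singleton l d ih =>
    have := invLength_mul_adjT_le (wordPerm n l) d
    simp only [wordPerm, List.map_append, List.prod_append, List.map_cons, List.map_nil,
      List.prod_singleton, List.length_append, List.length_singleton] at this ih ⊢
    omega

theorem invLength_rcPerm_le (n : ℕ) (R : Finset (ℕ × ℕ)) : invLength (rcPerm n R) ≤ R.card := by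
  simpa [rcPerm, rcWord] using invLength_wordPerm_le n (rcWord R)

/-- The number of rc-positions is the length of the longest permutation. -/
theorem card_fullRC (n : ℕ) : (fullRC n).card = invLength (w0 n) := by
  symm
  refine Finset.card_bij (fun p _ => ((p.1 : ℕ), (p.2 : ℕ) - p.1 - 1)) ?_ ?_ ?_
  · rintro ⟨p, q⟩ h
    simp only [Finset.mem_filter, Fin.lt_def, fullRC, Finset.mem_product, Finset.mem_range] at h ⊢
    omega
  · rintro ⟨p, q⟩ h ⟨p', q'⟩ h'
    simp only [Finset.mem_filter, Fin.lt_def, Prod.mk.injEq, Fin.ext_iff] at h h' ⊢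
    omega
  · rintro ⟨k, b⟩ h
    simp only [Finset.mem_filter, fullRC, Finset.mem_product, Finset.mem_range] at h
    refine ⟨(⟨k, by omega⟩, ⟨k + b + 1, by omega⟩), ?_, ?_⟩
    · simp only [Finset.mem_filter, Finset.mem_univ, true_and, w0, Fin.revPerm_apply,
        Fin.lt_def, Fin.val_rev]
      omega
    · simp only [Prod.mk.injEq, true_and]
      omega

/-! ### Permutations of sets of rc-positions -/

theorem mem_fullRC {n : ℕ} {p : ℕ × ℕ} : p ∈ fullRC n ↔ p.1 + p.2 + 2 ≤ n := by
  simp only [fullRC, Finset.mem_filter, Finset.mem_product, Finset.mem_range]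
  omega

theorem coe_adjT_apply {n : ℕ} (d : ℕ) (x : Fin n) : (adjT n d x : ℕ) =
    if d + 1 < n then if (x : ℕ) = d then d + 1 else if (x : ℕ) = d + 1 then d else x else x := by
  unfold adjT
  split_ifs with h h1 h2 <;> simp_all [Equiv.swap_apply_def, Fin.ext_iff]

theorem rcPerm_union (n : ℕ) {A B : Finset (ℕ × ℕ)}
    (h : ∀ a ∈ A, ∀ b ∈ B, rcLE a b ∧ a ≠ b) :
    rcPerm n (A ∪ B) = rcPerm n A * rcPerm n B := by
  have hd : Disjoint A B := Finset.disjoint_left.2 fun a ha hb => (h a ha a hb).2 rfl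
  have : (A ∪ B).sort rcLE = A.sort rcLE ++ B.sort rcLE := by
    refine List.Perm.eq_of_pairwise' (r := rcLE) (Finset.pairwise_sort _ _) ?_ ?_
    · refine List.pairwise_append.2 ⟨Finset.pairwise_sort _ _, Finset.pairwise_sort _ _, ?_⟩
      intro a ha b hb
      exact (h a (by simpa using ha) b (by simpa using hb)).1
    · refine (List.perm_ext_iff_of_nodup (Finset.sort_nodup _ _) ?_).2 (by simp)
      refine (List.nodup_append).2 ⟨Finset.sort_nodup _ _, Finset.sort_nodup _ _, ?_⟩
      intro a ha b hb
      exact (h a (by simpa using ha) b (by simpa using hb)).2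
  simp [rcPerm, rcWord, wordPerm, this]

theorem rcPerm_empty (n : ℕ) : rcPerm n ∅ = 1 := by
  simp [rcPerm, rcWord, wordPerm]

theorem rcPerm_singleton (n : ℕ) (p : ℕ × ℕ) : rcPerm n {p} = adjT n (p.1 + p.2) := by
  simp [rcPerm, rcWord, wordPerm]

theorem rcPerm_apply_of_lt {n c : ℕ} {R : Finset (ℕ × ℕ)} (h : ∀ q ∈ R, c ≤ q.1 + q.2)
    {x : Fin n} (hx : (x : ℕ) < c) : rcPerm n R x = x := by
  have key : ∀ l : List ℕ, (∀ d ∈ l, c ≤ d) → wordPerm n l x = x := by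
    intro l hl
    induction l with
    | nil => simp [wordPerm]
    | cons d l ih =>
      have h1 : wordPerm n (d :: l) x = adjT n d (wordPerm n l x) := by simp [wordPerm]
      have := hl d (by simp)
      rw [h1, ih fun e he => hl e (by simp [he])]
      ext
      rw [coe_adjT_apply]
      split_ifs <;> omega
  refine key _ fun d hd => ?_
  simp only [rcWord, List.mem_map, Finset.mem_sort] at hd
  obtain ⟨q, hq, rfl⟩ := hd
  exact h q hq

/-- The leftmost `b` positions of row `k`. -/
def rowSegment (k b : ℕ) : Finset (ℕ × ℕ) := (Finset.range b).image (Prod.mk k)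

theorem mem_rowSegment {k b : ℕ} {q : ℕ × ℕ} : q ∈ rowSegment k b ↔ q.1 = k ∧ q.2 < b := by
  obtain ⟨x, y⟩ := q
  simp only [rowSegment, Finset.mem_image, Finset.mem_range, Prod.mk.injEq]
  constructor
  · rintro ⟨a, h, rfl, rfl⟩
    exact ⟨rfl, h⟩
  · rintro ⟨rfl, h⟩
    exact ⟨y, h, rfl, rfl⟩

theorem coe_rcPerm_rowSegment_apply {n k b : ℕ} (h : k + b < n) (x : Fin n) :
    (rcPerm n (rowSegment k b) x : ℕ) =
      if (x : ℕ) = k then k + b else if k < x ∧ (x : ℕ) ≤ k + b then x - 1 else x := by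
  induction b with
  | zero =>
    simp only [rowSegment, Finset.range_zero, Finset.image_empty, rcPerm_empty,
      Equiv.Perm.one_apply]
    split_ifs <;> omega
  | succ b ih =>
    have : rowSegment k (b + 1) = {(k, b)} ∪ rowSegment k b := by
      ext q
      simp only [Finset.mem_union, Finset.mem_singleton, mem_rowSegment, Prod.ext_iff]
      omega
    rw [this, rcPerm_union, Equiv.Perm.mul_apply, rcPerm_singleton, coe_adjT_apply,
      ih (by omega)]
    · have := x.isLt
      split_ifs <;> omega
    · simp only [Finset.mem_singleton, mem_rowSegment, rcLE, ne_eq, Prod.ext_iff]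
      intros
      omega

/-- All valid positions in the first `k` rows. -/
def topRows (n k : ℕ) : Finset (ℕ × ℕ) := (fullRC n).filter (·.1 < k)

theorem mem_topRows {n k : ℕ} {q : ℕ × ℕ} :
    q ∈ topRows n k ↔ q.1 + q.2 + 2 ≤ n ∧ q.1 < k := by
  rw [topRows, Finset.mem_filter, mem_fullRC]

theorem coe_rcPerm_topRows_apply {n k : ℕ} (h : k ≤ n) (x : Fin n) :
    (rcPerm n (topRows n k) x : ℕ) = if (x : ℕ) < k then n - 1 - x else x - k := by
  induction k generalizing x with
  | zero => simp [topRows, rcPerm_empty]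
  | succ k ih =>
    have : topRows n (k + 1) = topRows n k ∪ rowSegment k (n - 1 - k) := by
      ext q
      simp only [Finset.mem_union, mem_topRows, mem_rowSegment]
      omega
    rw [this, rcPerm_union, Equiv.Perm.mul_apply, ih (by omega),
      coe_rcPerm_rowSegment_apply (by omega)]
    · have := x.isLt
      split_ifs <;> omega
    · simp only [mem_topRows, mem_rowSegment, rcLE, ne_eq, Prod.ext_iff]
      intros
      omega

theorem rcPerm_fullRC (n : ℕ) : rcPerm n (fullRC n) = w0 n := by
  have : fullRC n = topRows n n := by
    ext q
    rw [mem_topRows, mem_fullRC]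
    omega
  ext x
  rw [this, coe_rcPerm_topRows_apply le_rfl, if_pos x.isLt, w0, Fin.revPerm_apply, Fin.val_rev]
  omega

theorem assocRC_fullRC (n : ℕ) : AssocRC n (fullRC n) (w0 n) :=
  ⟨fun _ h => mem_fullRC.1 h, rcPerm_fullRC n, card_fullRC n⟩

theorem eq_fullRC_of_assocRC {n : ℕ} {R : Finset (ℕ × ℕ)} (h : AssocRC n R (w0 n)) :
    R = fullRC n :=
  Finset.eq_of_subset_of_card_le (fun p hp => mem_fullRC.2 (h.1 p hp))
    (by rw [h.2.2, card_fullRC])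

/-- Adjoining the first missing position multiplies the permutation by a transposition. -/
theorem exists_rcPerm_insert_eq {n k b : ℕ} {R : Finset (ℕ × ℕ)} (hR : IsRC n R)
    (hk : k + b + 2 ≤ n) (hp : (k, b) ∉ R)
    (hmin : ∀ q : ℕ × ℕ, q.1 + q.2 + 2 ≤ n → lexLt q (k, b) → q ∈ R) :
    ∃ i j : Fin n, (i : ℕ) = k ∧ i < j ∧ (rcPerm n R i : ℕ) = b ∧ rcPerm n R i < rcPerm n R j ∧
      rcPerm n (insert (k, b) R) = rcPerm n R * Equiv.swap i j := by
  set E := R.filter fun q => q.1 = k ∧ b < q.2 with hE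
  set C := R.filter fun q => k < q.1 with hC
  have mem_R : ∀ q, q ∈ R ↔ q ∈ topRows n k ∨ q ∈ E ∨ q ∈ rowSegment k b ∨ q ∈ C := by
    intro q
    simp only [hE, hC, mem_topRows, mem_rowSegment, Finset.mem_filter]
    constructor
    · intro hq
      have h1 := hR q hq
      have h2 : ¬(q.1 = k ∧ q.2 = b) := fun h => hp (by rwa [← h.1, ← h.2])
      simp only [hq, true_and]
      omega
    · rintro (h | h | h | h)
      · exact hmin q h.1 (Or.inl h.2)
      · exact h.1
      · exact hmin q (by omega) (Or.inr h)
      · exact h.1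
  have hR_eq : R = topRows n k ∪ (E ∪ (rowSegment k b ∪ C)) := by
    ext q
    simp only [mem_R q, Finset.mem_union]
  have hR_insert : insert (k, b) R =
      topRows n k ∪ (E ∪ ({(k, b)} ∪ (rowSegment k b ∪ C))) := by
    ext q
    simp only [mem_R q, Finset.mem_union, Finset.mem_insert, Finset.mem_singleton]
    tauto
  set T := rcPerm n (topRows n k)
  set D := rcPerm n (rowSegment k b) * rcPerm n C with hD
  have hu : rcPerm n R = T * (rcPerm n E * D) := by
    conv_lhs => rw [hR_eq]
    rw [rcPerm_union, rcPerm_union, rcPerm_union] <;>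
    · simp only [hE, hC, Finset.mem_union, mem_topRows, mem_rowSegment, Finset.mem_filter, rcLE,
        ne_eq, Prod.ext_iff]
      intros
      omega
  have hu' : rcPerm n (insert (k, b) R) = T * (rcPerm n E * (adjT n (k + b) * D)) := by
    rw [hR_insert, rcPerm_union, rcPerm_union, rcPerm_union, rcPerm_union, rcPerm_singleton] <;>
    · simp only [hE, hC, Finset.mem_union, mem_topRows, mem_rowSegment, Finset.mem_filter, rcLE,
        ne_eq, Prod.ext_iff, Finset.mem_singleton]
      intros
      omega
  have fixC : ∀ x : Fin n, (x : ℕ) < k + 1 → rcPerm n C x = x := fun x hx =>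
    rcPerm_apply_of_lt (fun q hq => by
      have := (Finset.mem_filter.1 hq).2
      omega) hx
  have fixE : ∀ x : Fin n, (x : ℕ) < k + b + 1 → rcPerm n E x = x := fun x hx =>
    rcPerm_apply_of_lt (fun q hq => by
      have := (Finset.mem_filter.1 hq).2
      omega) hx
  set i : Fin n := ⟨k, by omega⟩ with hi
  set r : Fin n := ⟨k + b, by omega⟩ with hr
  set s : Fin n := ⟨k + b + 1, by omega⟩ with hs
  have hDi : D i = r := by
    rw [hD, Equiv.Perm.mul_apply, fixC i (by simp [hi])]
    ext
    rw [coe_rcPerm_rowSegment_apply (by omega)]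
    simp [hi, hr]
  obtain ⟨j, hDj⟩ : ∃ j, D j = s := ⟨D⁻¹ s, by simp⟩
  have hDlt : ∀ x : Fin n, (x : ℕ) < k → D x = x := fun x hx => by
    rw [hD, Equiv.Perm.mul_apply, fixC x (by omega)]
    ext
    rw [coe_rcPerm_rowSegment_apply (by omega)]
    split_ifs <;> omega
  have hij : i < j := by
    by_contra hlt
    rcases lt_or_eq_of_le (not_lt.1 hlt) with h | h
    · rw [hDlt j (by simpa [hi, Fin.lt_def] using h), hs] at hDj
      rw [hDj, hi, Fin.lt_def] at h
      simp only at h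
      omega
    · rw [h, hDi, hr, hs] at hDj
      simp at hDj
  have hui : (rcPerm n R i : ℕ) = b := by
    rw [hu, Equiv.Perm.mul_apply, Equiv.Perm.mul_apply, hDi, fixE r (by simp [hr]),
      coe_rcPerm_topRows_apply (by omega)]
    simp [hr]
  have hEs : k + b + 1 ≤ (rcPerm n E s : ℕ) := by
    by_contra hlt
    have h := (rcPerm n E).injective (fixE (rcPerm n E s) (by omega))
    rw [h] at hlt
    simp [hs] at hlt
  have huj : (rcPerm n R i : ℕ) < rcPerm n R j := by
    rw [hui, hu, Equiv.Perm.mul_apply, Equiv.Perm.mul_apply, hDj,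
      coe_rcPerm_topRows_apply (by omega)]
    split_ifs <;> omega
  refine ⟨i, j, rfl, hij, hui, huj, ?_⟩
  have hadj : adjT n (k + b) = Equiv.swap (D i) (D j) := by
    rw [hDi, hDj, adjT, dif_pos (by omega)]
  rw [hu', hu, hadj, mul_assoc, mul_assoc, Equiv.mul_swap_eq_swap_mul]

/-- Adjoining the first missing position to an rc-graph gives an rc-graph, and the associated
permutations form a labeled cover. -/
theorem AssocRC.adjoin {n k b : ℕ} {R : Finset (ℕ × ℕ)} {u : Perm' n} (h : AssocRC n R u)
    (hk : k + b + 2 ≤ n) (hp : (k, b) ∉ R)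
    (hmin : ∀ q : ℕ × ℕ, q.1 + q.2 + 2 ≤ n → lexLt q (k, b) → q ∈ R) :
    AssocRC n (insert (k, b) R) (rcPerm n (insert (k, b) R)) ∧
      IsLabeledCover u (rcPerm n (insert (k, b) R)) k b := by
  obtain ⟨hR, rfl, hcard⟩ := h
  obtain ⟨i, j, hi, hij, hb, hu, heq⟩ := exists_rcPerm_insert_eq hR hk hp hmin
  have hlen := invLength_mul_swap (rcPerm n R) hij hu
  have hle := invLength_rcPerm_le n (insert (k, b) R)
  rw [Finset.card_insert_of_notMem hp, hcard] at hle
  rw [← heq] at hlen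
  have hempty : (Finset.univ.filter fun a => (i < a ∧ a < j) ∧
      rcPerm n R i < rcPerm n R a ∧ rcPerm n R a < rcPerm n R j).card = 0 := by omega
  refine ⟨⟨?_, rfl, ?_⟩, i, j, hij, hu, ?_, heq, hi.le, by rwa [← hi], hb.symm⟩
  · intro q hq
    rcases Finset.mem_insert.1 hq with rfl | hq
    exacts [hk, hR q hq]
  · rw [Finset.card_insert_of_notMem hp, hcard]
    omega
  · intro a h1 h2 h3
    rw [Finset.card_eq_zero, Finset.filter_eq_empty_iff] at hempty
    exact hempty (Finset.mem_univ a) ⟨⟨h1, h2⟩, h3⟩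

/-- Removing the last adjoined position undoes the corresponding labeled cover. -/
theorem AssocRC.of_adjoin {n k b : ℕ} {R : Finset (ℕ × ℕ)} {u u' : Perm' n}
    (h : AssocRC n (insert (k, b) R) u') (hp : (k, b) ∉ R)
    (hmin : ∀ q : ℕ × ℕ, q.1 + q.2 + 2 ≤ n → lexLt q (k, b) → q ∈ R)
    {i j : Fin n} (hi : (i : ℕ) = k) (hb : (u i : ℕ) = b) (hu : u' = u * Equiv.swap i j)
    (hlen : invLength u' = invLength u + 1) : AssocRC n R u := by
  have hR : IsRC n R := fun q hq => h.1 q (Finset.mem_insert_of_mem hq)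
  obtain ⟨i', j', hi', -, hb', -, heq⟩ :=
    exists_rcPerm_insert_eq hR (h.1 _ (Finset.mem_insert_self _ _)) hp hmin
  obtain rfl : i = i' := Fin.ext (hi.trans hi'.symm)
  rw [h.2.1] at heq
  have hj : u' j = u' j' := by
    rw [heq, Equiv.Perm.mul_apply _ _ j', Equiv.swap_apply_right, ← heq, hu,
      Equiv.Perm.mul_apply, Equiv.swap_apply_right]
    exact Fin.ext (hb.trans hb'.symm)
  obtain rfl := u'.injective hj
  refine ⟨hR, mul_right_cancel (heq.symm.trans hu), ?_⟩
  have := h.2.2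
  rw [Finset.card_insert_of_notMem hp] at this
  omega

/-! ### Increasing chains -/

theorem LabeledChain.invLength_eq {n m : ℕ} {u w : Perm' n} (γ : LabeledChain n m u w) :
    invLength w = invLength u + m := by
  have key : ∀ t (ht : t < m + 1), invLength (γ.c ⟨t, ht⟩) = invLength u + t := by
    intro t
    induction t with
    | zero => exact fun _ => congrArg invLength γ.c_zero
    | succ t ih =>
      intro ht
      have := (γ.step ⟨t, by omega⟩).invLength_eq
      simp only [Fin.castSucc_mk, Fin.succ_mk] at this
      rw [this, ih]
      rfl
  rw [← key m (by omega)]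
  exact congrArg invLength γ.c_last.symm

/-- Every step of an increasing chain to `w₀` labeled `(k, b)` moves the value in position `k`,
and all earlier positions already agree with `w₀`. -/
theorem LabeledChain.Increasing.step_spec {n m : ℕ} {w : Perm' n}
    {γ : LabeledChain n m w (w0 n)} (h : γ.Increasing) (s : Fin m) :
    ∃ i j : Fin n, (i : ℕ) = (γ.lab s).1 ∧ i < j ∧ γ.c s.castSucc i < γ.c s.castSucc j ∧
      γ.c s.succ = γ.c s.castSucc * Equiv.swap i j ∧
      (γ.c s.castSucc i : ℕ) = (γ.lab s).2 ∧ ∀ x < i, γ.c s.castSucc x = x.rev := by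
  induction hd : m - s using Nat.strong_induction_on generalizing s with
  | _ d ih =>
  obtain ⟨i, j, hij, hu, hcov, hw, hik, hkj, hb⟩ := γ.step s
  have next : (∀ x, γ.c s.succ x = x.rev) ∨
      ∃ i' : Fin n, (γ.lab s).1 ≤ i' ∧ (∀ x < i', γ.c s.succ x = x.rev) ∧
        ((γ.lab s).1 = i' → (γ.lab s).2 < γ.c s.succ i') := by
    by_cases hs : (s : ℕ) + 1 < m
    · right
      obtain ⟨i', j', hi', -, -, -, hb', hrev⟩ := ih _ (by simp; omega) ⟨s + 1, hs⟩ rfl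
      have hlt := h s ⟨s + 1, hs⟩ (by simp [Fin.lt_def])
      refine ⟨i', ?_, hrev, fun he => ?_⟩
      · rcases hlt with hlt | hlt <;> omega
      · change (γ.lab s).2 < (γ.c (Fin.castSucc ⟨s + 1, hs⟩) i' : ℕ)
        rcases hlt with hlt | hlt <;> omega
    · left
      intro x
      have : s.succ = Fin.last m := by
        ext
        simp
        omega
      rw [this, γ.c_last]
      rfl
  obtain ⟨k, hk⟩ : ∃ k : Fin n, (k : ℕ) = (γ.lab s).1 := ⟨⟨_, hkj.trans j.isLt⟩, rfl⟩
  have hrev : ∀ x < k, γ.c s.succ x = x.rev := by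
    intro x hx
    rcases next with hn | ⟨i', h1, h2, -⟩
    · exact hn x
    · exact h2 x (lt_of_lt_of_le hx (Fin.le_def.2 (hk ▸ h1)))
  have hswap_i : γ.c s.succ i = γ.c s.castSucc j := by rw [hw]; simp
  have hswap_j : γ.c s.succ j = γ.c s.castSucc i := by rw [hw]; simp
  have hswap : ∀ x, x ≠ i → x ≠ j → γ.c s.succ x = γ.c s.castSucc x := fun x h1 h2 => by
    rw [hw, Equiv.Perm.mul_apply, Equiv.swap_apply_of_ne_of_ne h1 h2]
  have low : ∀ y, k ≤ y → γ.c s.succ y ≤ k.rev := by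
    intro y hy
    by_contra hlt
    have hlt' : (γ.c s.succ y).rev < k := by
      rw [← Fin.rev_lt_rev, Fin.rev_rev]
      exact not_le.1 hlt
    have := hrev _ hlt'
    rw [Fin.rev_rev] at this
    rw [(γ.c s.succ).injective this] at hlt'
    exact absurd hlt' (not_lt.2 hy)
  have hkj' : k < j := Fin.lt_def.2 (hk ▸ hkj)
  have hi : i = k := by
    by_contra hne
    have hik' : i < k := lt_of_le_of_ne (Fin.le_def.2 (hk ▸ hik)) hne
    have hck := hswap k (Ne.symm hne) hkj'.ne
    have h1 : γ.c s.castSucc k < γ.c s.castSucc j := by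
      rw [← hck, ← hswap_i, hrev i hik']
      exact lt_of_le_of_lt (low k le_rfl) (Fin.rev_lt_rev.2 hik')
    have h2 : γ.c s.castSucc k < γ.c s.castSucc i :=
      lt_of_le_of_ne (not_lt.1 fun h' => hcov k hik' hkj' ⟨h', h1⟩)
        ((γ.c s.castSucc).injective.ne (Ne.symm hne))
    have h3 : γ.c s.succ k < k.rev := by
      rw [hck]
      exact lt_of_lt_of_le h2 (hswap_j ▸ low j hkj'.le)
    rcases next with hn | ⟨i', h4, h5, h6⟩
    · exact h3.ne (hn k)
    · have h7 : k = i' := by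
        by_contra hne'
        exact h3.ne (h5 k (lt_of_le_of_ne (Fin.le_def.2 (hk ▸ h4)) hne'))
      subst h7
      have := h6 hk.symm
      rw [hck, hb, ← Fin.lt_def] at this
      exact lt_asymm this h2
  subst hi
  refine ⟨i, j, hk, hij, hu, hw, hb.symm, fun x hx => ?_⟩
  rw [← hswap x hx.ne (hx.trans hij).ne, hrev x hx]

theorem LabeledChain.Increasing.lab_mem_fullRC {n m : ℕ} {w : Perm' n}
    {γ : LabeledChain n m w (w0 n)} (h : γ.Increasing) (s : Fin m) : γ.lab s ∈ fullRC n := by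
  obtain ⟨i, j, hi, hij, hu, -, hb, hrev⟩ := h.step_spec s
  rw [mem_fullRC, ← hi, ← hb]
  have hj : γ.c s.castSucc j ≤ i.rev := by
    by_contra hlt
    have hlt' : (γ.c s.castSucc j).rev < i := by
      rw [← Fin.rev_lt_rev, Fin.rev_rev]
      exact not_le.1 hlt
    have := hrev _ hlt'
    rw [Fin.rev_rev] at this
    rw [(γ.c s.castSucc).injective this] at hlt'
    exact lt_asymm hlt' hij
  rw [Fin.le_def, Fin.val_rev] at hj
  rw [Fin.lt_def] at hu
  omega

theorem LabeledChain.Increasing.lab_injective {n m : ℕ} {u w : Perm' n}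
    {γ : LabeledChain n m u w} (h : γ.Increasing) : Function.Injective γ.lab := by
  have irrefl : ∀ p, ¬lexLt p p := fun p hp => by unfold lexLt at hp; omega
  intro s t hst
  rcases lt_trichotomy s t with hlt | heq | hlt
  · exact absurd (hst ▸ h s t hlt) (irrefl _)
  · exact heq
  · exact absurd (hst ▸ h t s hlt) (irrefl _)

/-! ### Greedy sequences -/

theorem GreedyStep.unique {n : ℕ} {R S S' : Finset (ℕ × ℕ)} (h : GreedyStep n R S)
    (h' : GreedyStep n R S') : S = S' := by
  obtain ⟨p, hp, hpn, hmin, rfl⟩ := h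
  obtain ⟨p', hp', hpn', hmin', rfl⟩ := h'
  have h1 := hmin p' hpn' hp'
  have h2 := hmin' p hpn hp
  obtain rfl : p = p' := by
    rw [Prod.ext_iff]
    omega
  rfl

theorem exists_greedy_sequence {n d : ℕ} {R : Finset (ℕ × ℕ)} (hR : IsRC n R)
    (hd : (fullRC n \ R).card = d) :
    ∃ (Rs : ℕ → Finset (ℕ × ℕ)) (p : ℕ → ℕ × ℕ), Rs 0 = R ∧ Rs d = fullRC n ∧
      ∀ i < d, p i ∉ Rs i ∧ (p i).1 + (p i).2 + 2 ≤ n ∧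
        (∀ q : ℕ × ℕ, q.1 + q.2 + 2 ≤ n → q ∉ Rs i →
          ((p i).1 < q.1 ∨ ((p i).1 = q.1 ∧ (p i).2 ≤ q.2))) ∧
        Rs (i + 1) = insert (p i) (Rs i) := by
  induction d generalizing R with
  | zero =>
    refine ⟨fun _ => R, fun _ => 0, rfl, ?_, by simp⟩
    rw [Finset.card_eq_zero, Finset.sdiff_eq_empty_iff_subset] at hd
    exact subset_antisymm (fun q hq => mem_fullRC.2 (hR q hq)) hd
  | succ d ih =>
    obtain ⟨p, hp, hmin⟩ := Finset.exists_min_image (fullRC n \ R) toLex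
      (Finset.card_pos.1 (by omega))
    rw [Finset.mem_sdiff, mem_fullRC] at hp
    have hR' : IsRC n (insert p R) := by
      intro q hq
      rcases Finset.mem_insert.1 hq with rfl | hq
      exacts [hp.1, hR q hq]
    obtain ⟨Rs, ps, h0, hlast, hstep⟩ := ih hR' (by
      rw [Finset.sdiff_insert, Finset.card_erase_of_mem, hd, Nat.add_sub_cancel]
      rwa [Finset.mem_sdiff, mem_fullRC])
    refine ⟨fun i => i.casesOn R Rs, fun i => i.casesOn p ps, rfl, hlast, ?_⟩
    rintro (_ | i) hi
    · refine ⟨hp.2, hp.1, fun q hq hqR => ?_, h0⟩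
      have := hmin q (Finset.mem_sdiff.2 ⟨mem_fullRC.2 hq, hqR⟩)
      exact Prod.Lex.toLex_le_toLex.1 this
    · exact hstep i (by omega)

theorem exists_greedyRel {n : ℕ} {w : Perm' n} {R : Finset (ℕ × ℕ)} (hR : AssocRC n R w) :
    ∃ (m : ℕ) (γ : LabeledChain n m w (w0 n)), γ.Increasing ∧ GreedyRel n w R γ := by
  obtain ⟨Rs, p, h0, hlast, hstep⟩ := exists_greedy_sequence hR.1 rfl
  set m := (fullRC n \ R).card
  have hmin : ∀ i < m, ∀ q : ℕ × ℕ, q.1 + q.2 + 2 ≤ n → lexLt q (p i) → q ∈ Rs i := by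
    intro i hi q hq hlt
    by_contra hqR
    have := (hstep i hi).2.2.1 q hq hqR
    unfold lexLt at hlt
    omega
  have hassoc : ∀ i ≤ m, AssocRC n (Rs i) (rcPerm n (Rs i)) := by
    intro i
    induction i with
    | zero => exact fun _ => by rwa [h0, hR.2.1]
    | succ i ih =>
      intro hi
      obtain ⟨h1, h2, -, h3⟩ := hstep i hi
      rw [h3]
      exact ((ih (by omega)).adjoin h2 h1 (hmin i hi)).1
  have hmono : ∀ i j, i ≤ j → j ≤ m → Rs i ⊆ Rs j := by
    intro i j hij
    induction j, hij using Nat.le_induction with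
    | base => exact fun _ => subset_rfl
    | succ j hij ih =>
      intro hj
      rw [(hstep j hj).2.2.2]
      exact (ih (by omega)).trans (Finset.subset_insert _ _)
  refine ⟨m, ⟨fun i => rcPerm n (Rs i), fun i => p i, ?_, ?_, fun i => ?_⟩, ?_, Rs, h0, ?_, ?_,
    fun _ => rfl⟩
  · simp only [Fin.val_zero, h0, hR.2.1]
  · simp only [Fin.val_last, hlast, rcPerm_fullRC]
  · obtain ⟨h1, h2, -, h3⟩ := hstep i i.isLt
    simp only [Fin.val_castSucc, Fin.val_succ, h3]
    exact ((hassoc i i.isLt.le).adjoin h2 h1 (hmin i i.isLt)).2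
  · intro i j hij
    obtain ⟨-, -, h3, h4⟩ := hstep i i.isLt
    obtain ⟨h5, h6, -, -⟩ := hstep j j.isLt
    have h7 := h3 _ h6 fun hmem => h5 (hmono i j (le_of_lt hij) j.isLt.le hmem)
    have h8 : p i ≠ p j := fun heq => h5 (hmono (i + 1) j hij j.isLt.le (by
      rw [h4, heq]
      exact Finset.mem_insert_self _ _))
    rw [ne_eq, Prod.ext_iff] at h8
    change lexLt (p i) (p j)
    unfold lexLt
    omega
  · intro i hi
    exact ⟨p i, hstep i hi⟩
  · intro i
    exact ⟨(hstep i i.isLt).1, (hstep i i.isLt).2.2.2⟩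

theorem GreedyRel.chain_unique {n m : ℕ} {w : Perm' n} {R : Finset (ℕ × ℕ)}
    {γ γ' : LabeledChain n m w (w0 n)} (h : GreedyRel n w R γ) (h' : GreedyRel n w R γ') :
    γ = γ' := by
  obtain ⟨Rs, h0, hstep, hlab, hc⟩ := h
  obtain ⟨Rs', h0', hstep', hlab', hc'⟩ := h'
  have hRs : ∀ i ≤ m, Rs i = Rs' i := by
    intro i
    induction i with
    | zero => exact fun _ => h0.trans h0'.symm
    | succ i ih =>
      intro hi
      have := hstep i hi
      rw [ih (by omega)] at this
      exact this.unique (hstep' i hi)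
  have hceq : γ.c = γ'.c := funext fun i => by rw [← hc, ← hc', hRs i (by omega)]
  have hlabeq : γ.lab = γ'.lab := funext fun i => by
    have hmem : γ.lab i ∈ insert (γ'.lab i) (Rs' i) := by
      rw [← (hlab' i).2, ← hRs _ i.isLt, (hlab i).2]
      exact Finset.mem_insert_self _ _
    refine (Finset.mem_insert.1 hmem).resolve_right ?_
    rw [← hRs _ i.isLt.le]
    exact (hlab i).1
  cases γ
  cases γ'
  simp only at hceq hlabeq
  subst hceq hlabeq
  rfl

/-- The labels of the greedy chain of `R` are the valid positions outside `R`. -/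
theorem GreedyRel.disjoint_and_union {n m : ℕ} {w : Perm' n} {R : Finset (ℕ × ℕ)}
    {γ : LabeledChain n m w (w0 n)} (h : GreedyRel n w R γ) (hR : AssocRC n R w) :
    Disjoint R (Finset.univ.image γ.lab) ∧ R ∪ Finset.univ.image γ.lab = fullRC n := by
  obtain ⟨Rs, rfl, hstep, hlab, hc⟩ := h
  have key : ∀ t ≤ m, IsRC n (Rs t) ∧ (Rs t).card = (Rs 0).card + t ∧
      ∀ q, q ∈ Rs t ↔ q ∈ Rs 0 ∨ ∃ s : Fin m, (s : ℕ) < t ∧ γ.lab s = q := by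
    intro t
    induction t with
    | zero => exact fun _ => ⟨hR.1, rfl, by simp⟩
    | succ t ih =>
      intro ht
      obtain ⟨ih1, ih2, ih3⟩ := ih (by omega)
      obtain ⟨hl1, hl2⟩ := hlab ⟨t, ht⟩
      simp only at hl1 hl2
      refine ⟨?_, ?_, fun q => ?_⟩
      · obtain ⟨p, -, hp, -, heq⟩ := hstep t ht
        rw [heq]
        intro q hq
        rcases Finset.mem_insert.1 hq with rfl | hq
        exacts [hp, ih1 q hq]
      · rw [hl2, Finset.card_insert_of_notMem hl1, ih2, add_assoc]
      · rw [hl2, Finset.mem_insert, ih3]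
        constructor
        · rintro (rfl | hq | ⟨s, hs, rfl⟩)
          · exact Or.inr ⟨⟨t, ht⟩, Nat.lt_succ_self t, rfl⟩
          · exact Or.inl hq
          · exact Or.inr ⟨s, by omega, rfl⟩
        · rintro (hq | ⟨s, hs, rfl⟩)
          · exact Or.inr (Or.inl hq)
          · rcases Nat.lt_succ_iff_lt_or_eq.1 hs with hs | rfl
            · exact Or.inr (Or.inr ⟨s, hs, rfl⟩)
            · exact Or.inl rfl
  obtain ⟨hm1, hm2, hm3⟩ := key m le_rfl
  have hfull : Rs m = fullRC n := by
    refine eq_fullRC_of_assocRC ⟨hm1, ?_, ?_⟩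
    · rw [← γ.c_last, ← hc]
      rfl
    · rw [hm2, hR.2.2, γ.invLength_eq]
  refine ⟨Finset.disjoint_left.2 fun q hq hq' => ?_, ?_⟩
  · obtain ⟨s, -, rfl⟩ := Finset.mem_image.1 hq'
    exact (hlab s).1 (((key s s.isLt.le).2.2 _).2 (Or.inl hq))
  · ext q
    simp [← hfull, hm3]

/-- Every increasing chain to `w₀` is the greedy chain of some rc-graph. -/
theorem LabeledChain.Increasing.exists_greedyRel {n m : ℕ} {w : Perm' n}
    {γ : LabeledChain n m w (w0 n)} (h : γ.Increasing) :
    ∃ R, AssocRC n R w ∧ GreedyRel n w R γ := by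
  set Rs : ℕ → Finset (ℕ × ℕ) := fun t =>
    (fullRC n).filter fun q => ∀ s : Fin m, t ≤ s → γ.lab s ≠ q with hRs
  have mem_Rs : ∀ t q, q ∈ Rs t ↔ q ∈ fullRC n ∧ ∀ s : Fin m, t ≤ s → γ.lab s ≠ q :=
    fun t q => by rw [hRs, Finset.mem_filter]
  have hnot : ∀ s : Fin m, γ.lab s ∉ Rs s := fun s hs => ((mem_Rs _ _).1 hs).2 s le_rfl rfl
  have hinsert : ∀ s : Fin m, Rs (s + 1) = insert (γ.lab s) (Rs s) := by
    intro s
    ext q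
    rw [Finset.mem_insert, mem_Rs, mem_Rs]
    constructor
    · rintro ⟨h1, h2⟩
      by_cases hq : q = γ.lab s
      · exact Or.inl hq
      · refine Or.inr ⟨h1, fun r hr => ?_⟩
        rcases Nat.lt_or_eq_of_le hr with hr | hr
        · exact h2 r hr
        · rw [← Fin.ext hr]
          exact Ne.symm hq
    · rintro (rfl | ⟨h1, h2⟩)
      · refine ⟨h.lab_mem_fullRC s, fun r hr heq => ?_⟩
        have := h.lab_injective heq
        omega
      · exact ⟨h1, fun r hr => h2 r (by omega)⟩
  have hmin : ∀ s : Fin m, ∀ q : ℕ × ℕ, q.1 + q.2 + 2 ≤ n → q ∉ Rs s →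
      ((γ.lab s).1 < q.1 ∨ ((γ.lab s).1 = q.1 ∧ (γ.lab s).2 ≤ q.2)) := by
    intro s q hq hqR
    rw [mem_Rs, mem_fullRC] at hqR
    push Not at hqR
    obtain ⟨r, hr, rfl⟩ := hqR hq
    rcases eq_or_lt_of_le hr with hr | hr
    · rw [Fin.ext hr]
      omega
    · have := h s r hr
      unfold lexLt at this
      omega
  have hassoc : ∀ d t (ht : t < m + 1), t + d = m → AssocRC n (Rs t) (γ.c ⟨t, ht⟩) := by
    intro d
    induction d with
    | zero =>
      rintro t ht rfl
      have : Rs t = fullRC n := by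
        ext q
        rw [mem_Rs]
        exact and_iff_left fun s hs => absurd s.isLt (by omega)
      have hlast : γ.c ⟨t, ht⟩ = w0 n := γ.c_last
      rw [this, hlast]
      exact assocRC_fullRC n
    | succ d ih =>
      intro t ht htd
      have hnext := ih (t + 1) (by omega) (by omega)
      obtain ⟨i, j, hi, -, -, hw, hb, -⟩ := h.step_spec ⟨t, by omega⟩
      rw [hinsert ⟨t, by omega⟩] at hnext
      refine hnext.of_adjoin (hnot ⟨t, by omega⟩)
        (fun q hq (hlt : lexLt q (γ.lab ⟨t, _⟩)) => ?_) hi hb hw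
        (γ.step ⟨t, by omega⟩).invLength_eq
      by_contra hqR
      have := hmin ⟨t, by omega⟩ q hq hqR
      unfold lexLt at hlt
      omega
  refine ⟨Rs 0, ?_, Rs, rfl, fun i hi => ?_, fun i => ⟨hnot i, hinsert i⟩, fun i => ?_⟩
  · have := hassoc m 0 (by omega) (by omega)
    exact γ.c_zero ▸ this
  · exact ⟨γ.lab ⟨i, hi⟩, hnot ⟨i, hi⟩, mem_fullRC.1 (h.lab_mem_fullRC _), hmin ⟨i, hi⟩,
      hinsert ⟨i, hi⟩⟩
  · exact (hassoc (m - i) i i.isLt (by omega)).2.1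

/-- The greedy map `R ↦ γ(R)` is a bijection from `𝓡(w)` to
`Γ(w, w₀)`, the set of increasing chains from `w` to `w₀`; moreover
`x^R · x^{γ(R)} = x^δ` for every `R ∈ 𝓡(w)`. -/
theorem greedy_map_bijection (n : ℕ) (w : Perm' n) :
    (∀ R : Finset (ℕ × ℕ), AssocRC n R w →
      ∃! γ : ((m : ℕ) × {γ : LabeledChain n m w (w0 n) // γ.Increasing}),
        GreedyRel n w R γ.2.1) ∧
    (∀ γ : ((m : ℕ) × {γ : LabeledChain n m w (w0 n) // γ.Increasing}),
      ∃! R : {R : Finset (ℕ × ℕ) // AssocRC n R w}, GreedyRel n w R.1 γ.2.1) ∧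
    (∀ (R : Finset (ℕ × ℕ)) (m : ℕ) (γ : LabeledChain n m w (w0 n)),
      AssocRC n R w → γ.Increasing → GreedyRel n w R γ →
      ∀ i : Fin n, rcType n R i + chainType γ i = n - 1 - (i : ℕ)) := by
  refine ⟨fun R hR => ?_, fun ⟨m, γ, hγ⟩ => ?_, fun R m γ hR hγ h i => ?_⟩
  · obtain ⟨m, γ, hγ, h⟩ := exists_greedyRel hR
    refine ⟨⟨m, γ, hγ⟩, h, ?_⟩
    rintro ⟨m', γ', hγ'⟩ h'
    obtain rfl : m = m' := by
      have h1 := γ.invLength_eq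
      have h2 := γ'.invLength_eq
      omega
    obtain rfl := h.chain_unique h'
    rfl
  · obtain ⟨R, hR, h⟩ := hγ.exists_greedyRel
    refine ⟨⟨R, hR⟩, h, ?_⟩
    rintro ⟨R', hR'⟩ h'
    obtain ⟨hd, hu⟩ := h.disjoint_and_union hR
    obtain ⟨hd', hu'⟩ := GreedyRel.disjoint_and_union h' hR'
    rw [Subtype.mk.injEq, ← Finset.union_sdiff_cancel_right hd, hu, ← hu',
      Finset.union_sdiff_cancel_right hd']
  · obtain ⟨hd, hu⟩ := h.disjoint_and_union hR
    have hrow : (fullRC n).filter (·.1 = (i : ℕ)) = rowSegment i (n - 1 - i) := by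
      ext q
      rw [Finset.mem_filter, mem_fullRC, mem_rowSegment]
      omega
    have hlab : chainType γ i = ((Finset.univ.image γ.lab).filter (·.1 = (i : ℕ))).card := by
      rw [Finset.filter_image, Finset.card_image_of_injective _ hγ.lab_injective]
      rfl
    rw [hlab, rcType, ← Finset.card_union_of_disjoint (Finset.disjoint_filter_filter hd),
      ← Finset.filter_union, hu, hrow, rowSegment,
      Finset.card_image_of_injective _ (Prod.mk_right_injective _), Finset.card_range]
end
end

section
/- Let u ≤ w in Σ_n (Bruhat order), and let u', w' ∈ Σ_{n+1} denote their images under the standard inclusion Σ_n ⊂ Σ_{n+1} (fixing n+1). Then in the Laurent polynomial ring ℤ[x₁^{±1},…,x_{n+1}^{±1}] one has x^{−δ_{n+1}}·S^{(n+1)}_{w'/u'} = x^{−δ_n}·S^{(n)}_{w/u}, where S^{(m)}_{·/·} denotes the skew Schubert polynomial computed in ℤ[x₁,…,x_m] using the longest permutation of Σ_m and δ_m = (m−1,…,1,0). In other words, the Laurent polynomial x^{−δ}S_{w/u}(x) is independent of n. -/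
open MvPolynomial

noncomputable section

/-! ### Inversions and weak-order induction -/

/-- Multiplying on the right by the adjacent transposition of an ascent increases the length. -/
theorem invLength_lt_mul_swap {n : ℕ} (v : Perm' n) {a b : Fin n} (hab : (a : ℕ) + 1 = b)
    (hv : v a < v b) : invLength v < invLength (v * Equiv.swap a b) := by
  unfold invLength
  have hinj : Function.Injective (Prod.map (Equiv.swap a b) (Equiv.swap a b)) :=
    (Equiv.swap a b).injective.prodMap (Equiv.swap a b).injective
  rw [← Finset.card_image_of_injective _ hinj]
  apply Finset.card_lt_card
  rw [Finset.ssubset_iff_of_subset]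
  · refine ⟨(a, b), ?_, ?_⟩
    · have hlt : a < b := Fin.lt_def.mpr (by omega)
      exact Finset.mem_filter.mpr ⟨Finset.mem_univ _, hlt, by simpa using hv⟩
    · simp only [Finset.mem_image, Finset.mem_filter, Finset.mem_univ, true_and, Prod.exists,
        Prod.map_apply, Prod.mk.injEq, not_exists, not_and]
      rintro p q ⟨hpq, -⟩ hp hq
      rw [Equiv.swap_apply_eq_iff, Equiv.swap_apply_left] at hp
      rw [Equiv.swap_apply_eq_iff, Equiv.swap_apply_right] at hq
      subst hp hq
      rw [Fin.lt_def] at hpq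
      omega
  · intro x hx
    simp only [Finset.mem_image, Finset.mem_filter, Finset.mem_univ, true_and, Prod.exists,
      Prod.map_apply] at hx
    obtain ⟨p, q, ⟨hpq, hvpq⟩, rfl⟩ := hx
    refine Finset.mem_filter.mpr ⟨Finset.mem_univ _, ?_, by simpa using hvpq⟩
    have hne : ¬(p = a ∧ q = b) := by
      rintro ⟨rfl, rfl⟩
      exact lt_asymm hv hvpq
    simp only [Equiv.swap_apply_def]
    rw [Fin.lt_def] at hpq
    simp only [Fin.ext_iff] at hne ⊢
    split_ifs <;> rw [Fin.lt_def] <;> omega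

/-- Multiplying on the right by the adjacent transposition of a descent decreases the length. -/
theorem invLength_mul_swap_lt {n : ℕ} (v : Perm' n) {a b : Fin n} (hab : (a : ℕ) + 1 = b)
    (hv : v b < v a) : invLength (v * Equiv.swap a b) < invLength v := by
  have h := invLength_lt_mul_swap (v * Equiv.swap a b) hab (by simpa using hv)
  rwa [Equiv.mul_swap_mul_self] at h

theorem eq_w0_of_forall_descent {n : ℕ} (v : Perm' n)
    (h : ∀ (i : ℕ) (hi : i + 1 < n), v ⟨i + 1, hi⟩ < v ⟨i, by omega⟩) : v = w0 n := by
  have hanti : StrictAnti v := by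
    cases n with
    | zero => exact fun a => a.elim0
    | succ m =>
      rw [Fin.strictAnti_iff_succ_lt]
      intro i
      exact h i (by omega)
  have hmono : StrictMono (v * w0 n) := fun a b hab => hanti (Fin.rev_lt_rev.mpr hab)
  have hid : v * w0 n = 1 := by
    ext i
    have := Subsingleton.elim
      (StrictMono.orderIsoOfSurjective _ hmono (v * w0 n).surjective) (OrderIso.refl _)
    exact congrArg Fin.val (DFunLike.congr_fun this i)
  ext i
  have := DFunLike.congr_fun hid (Fin.rev i)
  simpa [w0] using congrArg Fin.val this

/-- Downward induction along the right weak order, starting from `w₀`. -/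
theorem perm_induction_descent {n : ℕ} {P : Perm' n → Prop} (hbase : P (w0 n))
    (hstep : ∀ (v : Perm' n) (i : ℕ) (hi : i + 1 < n), v ⟨i + 1, hi⟩ < v ⟨i, by omega⟩ → P v →
      P (v * Equiv.swap ⟨i, by omega⟩ ⟨i + 1, hi⟩)) (v : Perm' n) : P v := by
  have hbound : ∀ v : Perm' n, invLength v ≤ Fintype.card (Fin n × Fin n) :=
    fun v => Finset.card_le_univ _
  induction hm : Fintype.card (Fin n × Fin n) - invLength v using Nat.strong_induction_on
    generalizing v with
  | _ m ih =>
    by_cases hv : ∀ (i : ℕ) (hi : i + 1 < n), v ⟨i + 1, hi⟩ < v ⟨i, by omega⟩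
    · rw [eq_w0_of_forall_descent v hv]
      exact hbase
    · push Not at hv
      obtain ⟨i, hi, hle⟩ := hv
      have hlt : v ⟨i, by omega⟩ < v ⟨i + 1, hi⟩ :=
        lt_of_le_of_ne hle (v.injective.ne (by simp))
      have hlen := invLength_lt_mul_swap v (a := ⟨i, by omega⟩) (b := ⟨i + 1, hi⟩) rfl hlt
      have hP := ih _ (by have := hbound (v * Equiv.swap ⟨i, by omega⟩ ⟨i + 1, hi⟩); omega)
        (v * Equiv.swap ⟨i, by omega⟩ ⟨i + 1, hi⟩) rfl
      have := hstep _ i hi (by simpa using hlt) hP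
      rwa [Equiv.mul_swap_mul_self] at this

/-! ### Schubert polynomials under the inclusion `Σ_n ⊂ Σ_{n+1}` -/

theorem IsSchubertFamily.sub_rename_eq {n : ℕ} {S : Perm' n → MvPolynomial (Fin n) ℤ}
    (hS : IsSchubertFamily n S) (w : Perm' n) {a b : Fin n} (hab : (a : ℕ) + 1 = b)
    (hw : w b < w a) :
    S w - rename (Equiv.swap a b) (S w) = (X a - X b) * S (w * Equiv.swap a b) := by
  obtain ⟨a, ha⟩ := a
  obtain ⟨b, hb⟩ := b
  obtain rfl : a + 1 = b := hab
  exact hS.2 w a hb (invLength_mul_swap_lt w rfl hw)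

theorem X_sub_X_ne_zero {σ : Type*} {a b : σ} (hab : a ≠ b) :
    (X a - X b : MvPolynomial σ ℤ) ≠ 0 :=
  sub_ne_zero.mpr fun h => hab (X_injective h)

/-- Comparison of two Schubert families along a descent-preserving map commuting with the
adjacent transpositions, up to a factor symmetric in the first `n` variables. -/
theorem schubert_comparison {n : ℕ}
    {Sn : Perm' n → MvPolynomial (Fin n) ℤ} (hSn : IsSchubertFamily n Sn)
    {Sn1 : Perm' (n + 1) → MvPolynomial (Fin (n + 1)) ℤ} (hSn1 : IsSchubertFamily (n + 1) Sn1)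
    (T : Perm' n → Perm' (n + 1)) (P : MvPolynomial (Fin (n + 1)) ℤ)
    (hT : ∀ v (a b : Fin n), T (v * Equiv.swap a b) = T v * Equiv.swap a.castSucc b.castSucc)
    (hTlt : ∀ v (a b : Fin n), v b < v a → T v b.castSucc < T v a.castSucc)
    (hP : ∀ a b : Fin n, rename (Equiv.swap a.castSucc b.castSucc) P = P)
    (hbase : Sn1 (T (w0 n)) = P * rename Fin.castSucc (Sn (w0 n))) (v : Perm' n) :
    Sn1 (T v) = P * rename Fin.castSucc (Sn v) := by
  induction v using perm_induction_descent with
  | hbase => exact hbase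
  | hstep v i hi hlt ih =>
    set a : Fin n := ⟨i, by omega⟩
    set b : Fin n := ⟨i + 1, hi⟩
    have hab : a ≠ b := by simp [a, b]
    have e1 := hSn1.sub_rename_eq (T v) (a := a.castSucc) (b := b.castSucc) rfl (hTlt v a b hlt)
    have e2 := congrArg (fun f => P * rename Fin.castSucc f) (hSn.sub_rename_eq v (a := a) rfl hlt)
    have hcomm : (Equiv.swap a.castSucc b.castSucc : Fin (n + 1) → Fin (n + 1)) ∘ Fin.castSucc =
        Fin.castSucc ∘ Equiv.swap a b := by
      funext j
      exact (Fin.castSucc_injective n).swap_apply a b j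
    rw [ih, map_mul, hP, rename_rename, hcomm, ← rename_rename, ← hT] at e1
    simp only [map_sub, map_mul, rename_X] at e2
    refine mul_left_cancel₀ (X_sub_X_ne_zero ((Fin.castSucc_injective n).ne hab)) ?_
    linear_combination e2 - e1

theorem permIncl_castSucc {n : ℕ} (v : Perm' n) (i : Fin n) :
    permIncl (Nat.le_succ n) v i.castSucc = (v i).castSucc :=
  Equiv.Perm.extendDomain_apply_image v (finSubEquiv (Nat.le_succ n)) i

theorem permIncl_last {n : ℕ} (v : Perm' n) :
    permIncl (Nat.le_succ n) v (Fin.last n) = Fin.last n :=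
  Equiv.Perm.extendDomain_apply_not_subtype v (finSubEquiv (Nat.le_succ n)) (by simp)

theorem permIncl_mul_swap {n : ℕ} (v : Perm' n) (a b : Fin n) :
    permIncl (Nat.le_succ n) (v * Equiv.swap a b) =
      permIncl (Nat.le_succ n) v * Equiv.swap a.castSucc b.castSucc := by
  refine Equiv.ext fun j => ?_
  induction j using Fin.lastCases with
  | last =>
    rw [Equiv.Perm.mul_apply, Equiv.swap_apply_of_ne_of_ne (Fin.castSucc_ne_last a).symm
      (Fin.castSucc_ne_last b).symm, permIncl_last, permIncl_last]
  | cast j =>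
    rw [Equiv.Perm.mul_apply, (Fin.castSucc_injective n).swap_apply, permIncl_castSucc,
      permIncl_castSucc, Equiv.Perm.mul_apply]

theorem rename_prod_X_pow {σ : Type*} [Fintype σ] (s : Equiv.Perm σ) (e : σ → ℕ)
    (he : ∀ i, e (s i) = e i) :
    rename s (∏ i, X i ^ e i : MvPolynomial σ ℤ) = ∏ i, X i ^ e i := by
  rw [map_prod, ← Equiv.prod_comp s (fun i => (X i : MvPolynomial σ ℤ) ^ e i)]
  exact Finset.prod_congr rfl fun i _ => by rw [map_pow, rename_X, he]

/-- The Schubert polynomials of the permutations obtained from `w₀` by moving its largest value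
from position `0` to position `k`. -/
theorem IsSchubertFamily.exists_eq_prod {n : ℕ}
    {S : Perm' (n + 1) → MvPolynomial (Fin (n + 1)) ℤ} (hS : IsSchubertFamily (n + 1) S)
    (k : ℕ) (hk : k ≤ n) :
    ∃ c : Perm' (n + 1),
      (∀ i : Fin (n + 1), (c i : ℕ) =
        if (i : ℕ) < k then n - 1 - i else if (i : ℕ) = k then n else n - i) ∧
      S c = ∏ i : Fin (n + 1), X i ^ (if (i : ℕ) < k then n - 1 - (i : ℕ) else n - i) := by
  induction k with
  | zero =>
    refine ⟨w0 (n + 1), fun i => ?_, ?_⟩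
    · simp only [w0, Fin.revPerm_apply, Fin.val_rev]
      split_ifs <;> omega
    · rw [hS.1, xDelta]
      simp
  | succ k ih =>
    obtain ⟨c, hc, hSc⟩ := ih (by omega)
    obtain ⟨a, ha⟩ : ∃ a : Fin (n + 1), (a : ℕ) = k := ⟨⟨k, by omega⟩, rfl⟩
    obtain ⟨b, hb⟩ : ∃ b : Fin (n + 1), (b : ℕ) = k + 1 := ⟨⟨k + 1, by omega⟩, rfl⟩
    have hab : a ≠ b := by rw [ne_eq, Fin.ext_iff]; omega
    refine ⟨c * Equiv.swap a b, fun i => ?_, ?_⟩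
    · rw [Equiv.Perm.mul_apply, hc]
      rcases eq_or_ne i a with rfl | hia
      · rw [Equiv.swap_apply_left]
        split_ifs <;> omega
      rcases eq_or_ne i b with rfl | hib
      · rw [Equiv.swap_apply_right]
        split_ifs <;> omega
      rw [Equiv.swap_apply_of_ne_of_ne hia hib]
      rw [ne_eq, Fin.ext_iff] at hia hib
      split_ifs <;> omega
    · set e : Fin (n + 1) → ℕ :=
        fun i => if (i : ℕ) < k + 1 then n - 1 - (i : ℕ) else n - i with he
      have hsymm : ∀ i, e (Equiv.swap a b i) = e i := by
        intro i
        simp only [he]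
        rcases eq_or_ne i a with rfl | hia
        · rw [Equiv.swap_apply_left]
          split_ifs <;> omega
        rcases eq_or_ne i b with rfl | hib
        · rw [Equiv.swap_apply_right]
          split_ifs <;> omega
        rw [Equiv.swap_apply_of_ne_of_ne hia hib]
      have hfac : S c = X a * ∏ i, X i ^ e i := by
        rw [hSc, ← Finset.mul_prod_erase _ _ (Finset.mem_univ a),
          ← Finset.mul_prod_erase _ (fun i => (X i : MvPolynomial (Fin (n + 1)) ℤ) ^ e i)
          (Finset.mem_univ a), ← mul_assoc, ← pow_succ']
        congr 1
        · congr 1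
          simp only [he]
          split_ifs <;> omega
        · refine Finset.prod_congr rfl fun i hi => ?_
          have hik : (i : ℕ) ≠ k := fun h => Finset.ne_of_mem_erase hi (Fin.ext (h.trans ha.symm))
          congr 1
          simp only [he]
          split_ifs <;> omega
      have hlt : c b < c a := by
        rw [Fin.lt_def, hc, hc]
        split_ifs <;> omega
      have h := hS.sub_rename_eq c (a := a) (b := b) (by omega) hlt
      rw [hfac, map_mul, rename_X, Equiv.swap_apply_left, rename_prod_X_pow _ _ hsymm] at h
      refine mul_left_cancel₀ (X_sub_X_ne_zero hab) ?_
      linear_combination -h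

/-- Stability of Schubert polynomials under `Σ_n ⊂ Σ_{n+1}`. -/
theorem schubert_permIncl {n : ℕ}
    {Sn : Perm' n → MvPolynomial (Fin n) ℤ} (hSn : IsSchubertFamily n Sn)
    {Sn1 : Perm' (n + 1) → MvPolynomial (Fin (n + 1)) ℤ} (hSn1 : IsSchubertFamily (n + 1) Sn1)
    (v : Perm' n) : Sn1 (permIncl (Nat.le_succ n) v) = rename Fin.castSucc (Sn v) := by
  rw [← one_mul (rename _ _)]
  refine schubert_comparison hSn hSn1 _ 1 permIncl_mul_swap ?_ (fun _ _ => map_one _) ?_ v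
  · intro v a b h
    rwa [permIncl_castSucc, permIncl_castSucc, Fin.castSucc_lt_castSucc_iff]
  · obtain ⟨c, hc, hSc⟩ := hSn1.exists_eq_prod n le_rfl
    have : permIncl (Nat.le_succ n) (w0 n) = c := by
      ext j
      rw [hc]
      induction j using Fin.lastCases with
      | last => simp [permIncl_last]
      | cast j =>
        rw [permIncl_castSucc]
        simp [w0, Fin.val_rev]
        omega
    rw [this, hSc, hSn.1, xDelta, Fin.prod_univ_castSucc]
    simp [map_prod]

theorem rename_swap_prod_castSucc {n : ℕ} (a b : Fin n) :
    rename (Equiv.swap a.castSucc b.castSucc)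
      (∏ i : Fin n, X (Fin.castSucc i) : MvPolynomial (Fin (n + 1)) ℤ) =
      ∏ i : Fin n, X (Fin.castSucc i) := by
  rw [map_prod, ← Equiv.prod_comp (Equiv.swap a b)
    (fun i => (X (Fin.castSucc i) : MvPolynomial (Fin (n + 1)) ℤ))]
  exact Finset.prod_congr rfl fun i _ => by
    rw [rename_X, (Fin.castSucc_injective n).swap_apply]

/-- Passing from `w₀w` in `Σ_n` to `w₀w` in `Σ_{n+1}` multiplies the Schubert polynomial
by `x₁ ⋯ x_n`. -/
theorem schubert_w0_mul_permIncl {n : ℕ}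
    {Sn : Perm' n → MvPolynomial (Fin n) ℤ} (hSn : IsSchubertFamily n Sn)
    {Sn1 : Perm' (n + 1) → MvPolynomial (Fin (n + 1)) ℤ} (hSn1 : IsSchubertFamily (n + 1) Sn1)
    (w : Perm' n) :
    Sn1 (w0 (n + 1) * permIncl (Nat.le_succ n) w) =
      (∏ i : Fin n, X (Fin.castSucc i)) * rename Fin.castSucc (Sn (w0 n * w)) := by
  have hinv : ∀ v : Perm' n, w0 n * (w0 n * v) = v := fun v => by ext; simp [w0]
  have key := schubert_comparison hSn hSn1
    (fun v => w0 (n + 1) * permIncl (Nat.le_succ n) (w0 n * v))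
    (∏ i : Fin n, X (Fin.castSucc i)) ?_ ?_ rename_swap_prod_castSucc ?_ (w0 n * w)
  · simpa only [hinv] using key
  · intro v a b
    rw [← mul_assoc, permIncl_mul_swap, mul_assoc]
  · intro v a b h
    simpa [w0, permIncl_castSucc] using h
  · have hid : w0 (n + 1) * permIncl (Nat.le_succ n) (w0 n * w0 n) = w0 (n + 1) := by
      have h1 : w0 n * w0 n = 1 := by simpa using hinv 1
      rw [h1, permIncl, Equiv.Perm.extendDomain_one, mul_one]
    simp only [hid]
    rw [hSn1.1, hSn.1, xDelta, xDelta, Fin.prod_univ_castSucc, map_prod, ← Finset.prod_mul_distrib]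
    simp only [Fin.val_last, Nat.add_sub_cancel, Nat.sub_self, pow_zero, mul_one, map_pow, rename_X]
    refine Finset.prod_congr rfl fun i _ => ?_
    rw [← pow_succ']
    congr 1
    simp
    omega

/-! ### The ideals of symmetric polynomials -/

theorem Multiset.esymm_cons_succ {R : Type*} [CommSemiring R] (a : R) (s : Multiset R) (k : ℕ) :
    (a ::ₘ s).esymm (k + 1) = s.esymm (k + 1) + a * s.esymm k := by
  simp only [Multiset.esymm, Multiset.powersetCard_cons, Multiset.map_add, Multiset.sum_add,
    Multiset.map_map, Function.comp_def, Multiset.prod_cons, Multiset.sum_map_mul_left]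

theorem esymm_fin_succ (n k : ℕ) :
    esymm (Fin (n + 1)) ℤ (k + 1) = rename Fin.castSucc (esymm (Fin n) ℤ (k + 1)) +
      X (Fin.last n) * rename Fin.castSucc (esymm (Fin n) ℤ k) := by
  have h (j : ℕ) : rename Fin.castSucc (esymm (Fin n) ℤ j) =
      (Finset.univ.val.map (X ∘ Fin.castSucc : Fin n → MvPolynomial (Fin (n + 1)) ℤ)).esymm j := by
    have hren : (rename Fin.castSucc : MvPolynomial (Fin n) ℤ →ₐ[ℤ] MvPolynomial (Fin (n + 1)) ℤ) =
        aeval (X ∘ Fin.castSucc) := algHom_ext (by simp)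
    rw [hren, aeval_esymm_eq_multiset_esymm]
  rw [h, h, ← Multiset.esymm_cons_succ, esymm_eq_multiset_esymm, Fin.univ_castSuccEmb]
  simp [Function.comp_def]

theorem prod_castSucc_mul_rename_esymm_mem {n k : ℕ} (hk : k ∈ Set.Icc 1 n) :
    (∏ i : Fin n, X (Fin.castSucc i)) * rename Fin.castSucc (esymm (Fin n) ℤ k) ∈
      symIdeal (n + 1) := by
  obtain ⟨k, rfl⟩ : ∃ m, k = m + 1 := ⟨k - 1, by have := hk.1; omega⟩
  have hmem : ∀ j ∈ Set.Icc 1 (n + 1), esymm (Fin (n + 1)) ℤ j ∈ symIdeal (n + 1) :=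
    fun j hj => Ideal.subset_span ⟨j, hj, rfl⟩
  have h1 := hmem (k + 1) ⟨hk.1, hk.2.trans (Nat.le_succ n)⟩
  have h2 := hmem (n + 1) ⟨by omega, le_rfl⟩
  have htop : esymm (Fin (n + 1)) ℤ (n + 1) =
      (∏ i : Fin n, X (Fin.castSucc i)) * X (Fin.last n) := by
    have : Finset.powersetCard (n + 1) (Finset.univ : Finset (Fin (n + 1))) = {Finset.univ} := by
      simpa using Finset.powersetCard_self (Finset.univ : Finset (Fin (n + 1)))
    rw [esymm, this, Finset.sum_singleton, Fin.prod_univ_castSucc]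
  have : (∏ i : Fin n, X (Fin.castSucc i)) * rename Fin.castSucc (esymm (Fin n) ℤ (k + 1)) =
      (∏ i : Fin n, X (Fin.castSucc i)) * esymm (Fin (n + 1)) ℤ (k + 1) -
        rename Fin.castSucc (esymm (Fin n) ℤ k) * esymm (Fin (n + 1)) ℤ (n + 1) := by
    rw [htop, esymm_fin_succ]
    ring
  rw [this]
  exact sub_mem (Ideal.mul_mem_left _ _ h1) (Ideal.mul_mem_left _ _ h2)

theorem prod_castSucc_mul_rename_mem {n : ℕ} {f : MvPolynomial (Fin n) ℤ}
    (hf : f ∈ symIdeal n) :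
    (∏ i : Fin n, X (Fin.castSucc i)) * rename Fin.castSucc f ∈ symIdeal (n + 1) := by
  induction hf using Submodule.span_induction with
  | mem f hf =>
    obtain ⟨k, hk, rfl⟩ := hf
    exact prod_castSucc_mul_rename_esymm_mem hk
  | zero => simp
  | add f g _ _ hf hg =>
    rw [map_add, mul_add]
    exact add_mem hf hg
  | smul r f _ hf =>
    rw [smul_eq_mul, map_mul, mul_left_comm]
    exact Ideal.mul_mem_left _ _ hf

/-- The antisymmetrization `∑ σ, sgn(σ) σ(f)` of a polynomial. -/
def alternation {n : ℕ} (f : MvPolynomial (Fin n) ℤ) : MvPolynomial (Fin n) ℤ :=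
  ∑ σ : Equiv.Perm (Fin n), (Equiv.Perm.sign σ : ℤ) • rename σ f

theorem rename_swap_alternation {n : ℕ} {a b : Fin n} (hab : a ≠ b) (f : MvPolynomial (Fin n) ℤ) :
    rename (Equiv.swap a b) (alternation f) = -alternation f := by
  rw [alternation, map_sum, ← Finset.sum_neg_distrib]
  refine Fintype.sum_equiv (Equiv.mulLeft (Equiv.swap a b)) _ _ fun σ => ?_
  rw [map_zsmul, rename_rename, Equiv.coe_mulLeft, Equiv.Perm.sign_mul, Equiv.Perm.sign_swap hab,
    Equiv.Perm.coe_mul]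
  simp

theorem alternation_mul_esymm {n : ℕ} (f : MvPolynomial (Fin n) ℤ) (k : ℕ) :
    alternation (f * esymm (Fin n) ℤ k) = alternation f * esymm (Fin n) ℤ k := by
  simp only [alternation, Finset.sum_mul, map_mul, rename_esymm, smul_mul_assoc]

theorem coeff_alternation_eq_zero {n : ℕ} (f : MvPolynomial (Fin n) ℤ) {d : Fin n →₀ ℕ}
    {a b : Fin n} (hab : a ≠ b) (hd : d a = d b) : coeff d (alternation f) = 0 := by
  have h := coeff_rename_mapDomain (Equiv.swap a b) (Equiv.injective _) (alternation f) d
  have hd' : d.mapDomain (Equiv.swap a b) = d := by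
    ext j
    rw [Finsupp.mapDomain_equiv_apply, Equiv.symm_swap, Equiv.swap_apply_def]
    split_ifs with h1 h2 <;> simp_all
  rw [hd', rename_swap_alternation hab, coeff_neg] at h
  omega

theorem eq_deltaF_of_injective {n : ℕ} {d : Fin n →₀ ℕ} (hinj : Function.Injective d)
    (hle : d ≤ deltaF n) : d = deltaF n := by
  have hle' : ∀ i : Fin n, d i ≤ n - 1 - (i : ℕ) := hle
  have key : ∀ m : ℕ, ∀ i : Fin n, n - 1 - (i : ℕ) = m → d i = m := by
    intro m
    induction m using Nat.strong_induction_on with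
    | _ m ih =>
      intro i hi
      by_contra hne
      have hlt : d i < m := by have := hle' i; omega
      have hj := ih (d i) hlt ⟨n - 1 - d i, by omega⟩ (by simp; omega)
      have := congrArg Fin.val (hinj hj)
      simp at this
      omega
  ext i
  exact key _ i rfl

/-- The coefficient of `x^δ` in the antisymmetrization vanishes on the ideal generated by the
elementary symmetric polynomials. -/
theorem coeff_deltaF_alternation_eq_zero {n : ℕ} {f : MvPolynomial (Fin n) ℤ}
    (hf : f ∈ symIdeal n) : coeff (deltaF n) (alternation f) = 0 := by
  suffices h : ∀ r, coeff (deltaF n) (alternation (r * f)) = 0 by simpa using h 1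
  induction hf using Submodule.span_induction with
  | mem f hf =>
    obtain ⟨k, hk, rfl⟩ := hf
    intro r
    rw [alternation_mul_esymm, esymm_eq_sum_monomial, Finset.mul_sum, coeff_sum]
    refine Finset.sum_eq_zero fun t ht => ?_
    rw [coeff_mul_monomial']
    split_ifs with hle
    · obtain ⟨i, hi⟩ : t.Nonempty := by
        rw [← Finset.card_pos, (Finset.mem_powersetCard.mp ht).2]
        exact hk.1
      have hti : (∑ j ∈ t, Finsupp.single j 1 : Fin n →₀ ℕ) i = 1 := by
        simp [Finsupp.finsetSum_apply, Finsupp.single_apply, hi]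
      have hninj : ¬Function.Injective (deltaF n - ∑ j ∈ t, Finsupp.single j 1 : Fin n →₀ ℕ) := by
        intro hinj
        have h1 := DFunLike.congr_fun (eq_deltaF_of_injective hinj tsub_le_self) i
        have h2 := hle i
        rw [Finsupp.tsub_apply] at h1
        omega
      simp only [Function.Injective, not_forall] at hninj
      obtain ⟨a, b, hd, hab⟩ := hninj
      rw [coeff_alternation_eq_zero r hab hd, zero_mul]
    · rfl
  | zero => simp [alternation]
  | add f g _ _ hf hg =>
    intro r
    have := congrArg₂ (· + ·) (hf r) (hg r)
    simpa [alternation, mul_add, Finset.sum_add_distrib] using this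
  | smul c f _ hf =>
    intro r
    rw [smul_eq_mul, ← mul_assoc]
    exact hf _

theorem coeff_deltaF_alternation {n : ℕ} (f : MvPolynomial (Fin n) ℤ) :
    coeff (deltaF n) (alternation f) = ∑ σ : Equiv.Perm (Fin n),
      (Equiv.Perm.sign σ : ℤ) * coeff ((deltaF n).mapDomain σ.symm) f := by
  rw [alternation, coeff_sum]
  refine Finset.sum_congr rfl fun σ _ => ?_
  rw [coeff_smul, smul_eq_mul]
  congr 1
  conv_lhs => rw [show deltaF n = ((deltaF n).mapDomain σ.symm).mapDomain σ by
    rw [← Finsupp.mapDomain_comp]; simp]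
  exact coeff_rename_mapDomain _ σ.injective _ _

/-- A nontrivial combination of divisors of `x^δ` is not in the ideal generated by the
elementary symmetric polynomials. -/
theorem eq_zero_of_mem_symIdeal {n : ℕ} {g : MvPolynomial (Fin n) ℤ} (hg : g ∈ symIdeal n)
    (hsupp : ∀ d ∈ g.support, ∀ i : Fin n, d i ≤ n - 1 - (i : ℕ)) : g = 0 := by
  by_contra hne
  obtain ⟨a, ha, hmax⟩ := g.support.exists_max_image
    (fun d => toLex (fun i => d (Fin.rev i))) (support_nonempty.mpr hne)
  have haδ : a ≤ deltaF n := hsupp a ha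
  have h := coeff_deltaF_alternation_eq_zero
    (Ideal.mul_mem_left _ (monomial (deltaF n - a) (1 : ℤ)) hg)
  rw [coeff_deltaF_alternation, Finset.sum_eq_single 1] at h
  · have hid : (deltaF n).mapDomain (Equiv.symm (1 : Equiv.Perm (Fin n))) = deltaF n :=
      Finsupp.mapDomain_id
    rw [coeff_monomial_mul', hid, if_pos tsub_le_self, tsub_tsub_cancel_of_le haδ] at h
    refine mem_support_iff.mp ha ?_
    simpa using h
  · intro σ _ hσ
    rw [coeff_monomial_mul']
    split_ifs with hle
    · rw [one_mul]
      convert mul_zero _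
      by_contra hcoeff
      refine (hmax _ (mem_support_iff.mpr hcoeff)).not_gt ?_
      have hne' : (Finset.univ.filter fun i => σ i ≠ i).Nonempty := by
        by_contra hemp
        refine hσ (Equiv.ext fun i => ?_)
        simpa using Finset.filter_eq_empty_iff.mp (Finset.not_nonempty_iff_eq_empty.mp hemp)
          (Finset.mem_univ i)
      obtain ⟨i, hi, himax⟩ := Finset.exists_max_image _ id hne'
      have hi' : σ i ≠ i := (Finset.mem_filter.mp hi).2
      have hfix : ∀ j, i < j → σ j = j := by
        intro j hj
        by_contra hσj
        exact absurd (himax j (Finset.mem_filter.mpr ⟨Finset.mem_univ _, hσj⟩)) (not_le.mpr hj)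
      have hlt : σ i < i := by
        by_contra hnlt
        exact hi' (σ.injective (hfix _ (lt_of_le_of_ne (not_lt.mp hnlt) hi'.symm)))
      have hval (j : Fin n) : ((deltaF n).mapDomain σ.symm - (deltaF n - a)) j =
          (n - 1 - (σ j : ℕ)) - (n - 1 - (j : ℕ) - a j) := by
        rw [Finsupp.tsub_apply, Finsupp.mapDomain_equiv_apply]
        rfl
      have haj (j : Fin n) : a j ≤ n - 1 - (j : ℕ) := haδ j
      refine ⟨Fin.rev i, fun j hj => ?_, ?_⟩
      · have hj' : i < Fin.rev j := Fin.lt_rev_iff.mpr hj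
        have := haj (Fin.rev j)
        simp only [Pi.toLex_apply, hval, hfix _ hj']
        omega
      · have := haj i
        have := i.isLt
        rw [Fin.lt_def] at hlt
        simp only [Pi.toLex_apply, Fin.rev_rev, hval]
        omega
    · simp
  · simp

theorem IsNormalForm.unique {n : ℕ} {f g g' : MvPolynomial (Fin n) ℤ}
    (h : IsNormalForm n f g) (h' : IsNormalForm n f g') : g = g' := by
  rw [← sub_eq_zero]
  refine eq_zero_of_mem_symIdeal ?_ fun d hd i => ?_
  · have := sub_mem h'.1 h.1
    rwa [sub_sub_sub_cancel_left] at this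
  · rcases Finset.mem_union.mp (support_sub _ _ _ hd) with hd | hd
    · exact h.2 d hd i
    · exact h'.2 d hd i

theorem IsNormalForm.prod_castSucc_mul_rename {n : ℕ} {f g : MvPolynomial (Fin n) ℤ}
    (h : IsNormalForm n f g) :
    IsNormalForm (n + 1) ((∏ i : Fin n, X (Fin.castSucc i)) * rename Fin.castSucc f)
      ((∏ i : Fin n, X (Fin.castSucc i)) * rename Fin.castSucc g) := by
  refine ⟨?_, ?_⟩
  · rw [← mul_sub, ← map_sub]
    exact prod_castSucc_mul_rename_mem h.1
  · intro d hd i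
    have hP : (∏ i : Fin n, X (Fin.castSucc i) : MvPolynomial (Fin (n + 1)) ℤ) =
        monomial (∑ i : Fin n, Finsupp.single (Fin.castSucc i) 1) 1 := by
      rw [monomial_sum_one]
      rfl
    rw [hP, mem_support_iff, coeff_monomial_mul', ite_ne_right_iff, one_mul] at hd
    obtain ⟨hle, hd⟩ := hd
    obtain ⟨e, he, hge⟩ := coeff_rename_ne_zero _ _ _ hd
    rw [← tsub_add_cancel_of_le hle, ← he, Finsupp.add_apply]
    induction i using Fin.lastCases with
    | last =>
      rw [Finsupp.mapDomain_of_notMem_range _ _ (by simp)]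
      simp [Finsupp.finsetSum_apply]
    | cast i =>
      rw [Finsupp.mapDomain_apply (Fin.castSucc_injective n)]
      have := h.2 e (mem_support_iff.mpr hge) i
      simp [Finsupp.finsetSum_apply, Finsupp.single_apply]
      omega

/-- The Laurent polynomial `x^{-δ} S_{w/u}` is independent of `n`:
passing from `Σ_n` to `Σ_{n+1}` multiplies the skew Schubert polynomial exactly by
`x^{δ_{n+1}} / x^{δ_n} = x₁ ⋯ x_n`. -/
theorem skew_schubert_stability (n : ℕ)
    (Sn : Perm' n → MvPolynomial (Fin n) ℤ) (hSn : IsSchubertFamily n Sn)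
    (Sn1 : Perm' (n + 1) → MvPolynomial (Fin (n + 1)) ℤ)
    (hSn1 : IsSchubertFamily (n + 1) Sn1)
    (u w : Perm' n) (huw : BruhatLE u w)
    (skw : MvPolynomial (Fin n) ℤ) (skw' : MvPolynomial (Fin (n + 1)) ℤ)
    (h1 : IsNormalForm n (Sn u * Sn (w0 n * w)) skw)
    (h2 : IsNormalForm (n + 1)
      (Sn1 (permIncl (Nat.le_succ n) u) *
        Sn1 (w0 (n + 1) * permIncl (Nat.le_succ n) w)) skw') :
    skw' = (∏ i : Fin n, X (Fin.castSucc i)) * rename Fin.castSucc skw := by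
  refine h2.unique ?_
  rw [schubert_permIncl hSn hSn1, schubert_w0_mul_permIncl hSn hSn1, mul_left_comm, ← map_mul]
  exact h1.prod_castSucc_mul_rename
end
end

section
/- Let u ∈ Σ_n with u ≠ w₀, and let γ be any increasing chain in the labeled Bruhat order from u to w₀. Then the first edge of γ is u →^{(k,u(k))} u·(k,l) for some l > k, where k is the minimal index i such that u(i) + i < n + 1. In particular, the possible first steps of increasing chains from u to w₀ depend only on u: they are exactly the covers u ⋖ u·(k,l) with this k, b = u(k), and l > k such that u(l) > u(k) and no i with k < i < l has u(k) < u(i) < u(l). -/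
open MvPolynomial

noncomputable section

/-- `u` agrees with `w₀` in all positions below `k`. -/
def AgreesBelow {n : ℕ} (u : Perm' n) (k : ℕ) : Prop :=
  ∀ i : Fin n, (i : ℕ) < k → (i : ℕ) + (u i : ℕ) + 1 = n

/-- `k` is the smallest position with `u(k) < w₀(k)`. -/
def IsFirstDefect {n : ℕ} (u : Perm' n) (k : Fin n) : Prop :=
  (k : ℕ) + (u k : ℕ) + 2 ≤ n ∧ ∀ i : Fin n, (i : ℕ) + (u i : ℕ) + 2 ≤ n → k ≤ i

theorem w0_apply_val {n : ℕ} (i : Fin n) : (w0 n i : ℕ) = n - (i + 1) := by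
  simp [w0, Fin.val_rev]

theorem agreesBelow_w0 {n : ℕ} (k : ℕ) : AgreesBelow (w0 n) k := by
  intro i _
  have := i.isLt
  rw [w0_apply_val]
  omega

/-- If the values of `u` below `k` are at least those of `w₀`, then they are equal to them. -/
theorem agreesBelow_of_le {n : ℕ} {u : Perm' n} {k : ℕ}
    (h : ∀ i : Fin n, (i : ℕ) < k → n ≤ (i : ℕ) + (u i : ℕ) + 1) : AgreesBelow u k := by
  intro i
  induction i using WellFoundedLT.induction with
  | ind i ih =>
    intro hi
    by_contra hne
    have h1 := h i hi
    have h2 := (u i).isLt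
    let j : Fin n := ⟨n - 1 - u i, by omega⟩
    have hji : j < i := by simp only [Fin.lt_def, j]; omega
    have hj := ih j hji (by simp only [Fin.lt_def] at hji; omega)
    have hjv : (j : ℕ) = n - 1 - u i := rfl
    have huj : u j = u i := Fin.ext (by omega)
    exact hji.ne (u.injective huj)

/-- If `u` agrees with `w₀` below `k`, its values from position `k` on are at most `w₀(k)`. -/
theorem AgreesBelow.apply_le {n : ℕ} {u : Perm' n} {k : ℕ} (h : AgreesBelow u k)
    {j : Fin n} (hj : k ≤ (j : ℕ)) : (u j : ℕ) + k + 1 ≤ n := by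
  by_contra hlt
  have h2 := (u j).isLt
  let i : Fin n := ⟨n - 1 - u j, by omega⟩
  have hiv : (i : ℕ) = n - 1 - u j := rfl
  have hi := h i (by omega)
  have hij : i = j := u.injective (Fin.ext (by omega))
  rw [hij] at hiv hi
  omega

theorem IsFirstDefect.agreesBelow {n : ℕ} {u : Perm' n} {k : Fin n} (h : IsFirstDefect u k) :
    AgreesBelow u k := by
  refine agreesBelow_of_le fun i hi => ?_
  by_contra hlt
  have := h.2 i (by omega)
  rw [Fin.le_def] at this
  omega

theorem AgreesBelow.isFirstDefect {n : ℕ} {u : Perm' n} {k l : Fin n} (h : AgreesBelow u k)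
    (hkl : k < l) (hu : u k < u l) : IsFirstDefect u k := by
  refine ⟨?_, fun i hi => ?_⟩
  · have := h.apply_le hkl.le
    rw [Fin.lt_def] at hu
    omega
  · by_contra hlt
    have := h i (by simpa using hlt)
    omega

theorem exists_isFirstDefect {n : ℕ} {u : Perm' n} (hu : u ≠ w0 n) :
    ∃ k, IsFirstDefect u k := by
  have hne : {i : Fin n | (i : ℕ) + (u i : ℕ) + 2 ≤ n}.Nonempty := by
    by_contra hempty
    have hall : AgreesBelow u n := agreesBelow_of_le fun i _ => by
      by_contra hlt
      exact hempty ⟨i, by simp only [Set.mem_ofPred_eq]; omega⟩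
    refine hu (Equiv.ext fun i => Fin.ext ?_)
    have := hall i i.isLt
    rw [w0_apply_val]
    omega
  obtain ⟨k, hk, hmin⟩ := wellFounded_lt.has_min _ hne
  exact ⟨k, hk, fun i hi => not_lt.mp (hmin i hi)⟩

/-- At its first defect, a permutation has a cover exchanging the defect with a later position. -/
theorem IsFirstDefect.exists_cover {n : ℕ} {u : Perm' n} {k : Fin n} (h : IsFirstDefect u k) :
    ∃ l, k < l ∧ u k < u l ∧ ∀ i : Fin n, k < i → i < l → ¬(u k < u i ∧ u i < u l) := by
  have hne : {l : Fin n | k < l ∧ u k < u l}.Nonempty := by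
    have h1 := h.1
    let p : Fin n := u.symm ⟨n - 1 - k, by omega⟩
    have hp : (u p : ℕ) = n - 1 - k := by simp [p]
    refine ⟨p, ?_, by rw [Fin.lt_def]; omega⟩
    by_contra hlt
    rcases (not_lt.mp hlt).lt_or_eq with hpk | hpk
    · have := h.agreesBelow p hpk
      rw [Fin.lt_def] at hpk
      omega
    · rw [hpk] at hp
      omega
  obtain ⟨l, hl, hmin⟩ := wellFounded_lt.has_min _ hne
  exact ⟨l, hl.1, hl.2, fun i hki hil hi => hmin i ⟨hki, hi.1⟩ hil⟩

/-- If `v` agrees with `w₀` below `k` and `b < v(k)`, then a cover of `v` from below labeled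
`(k,b)` exchanges position `k` with a later one. -/
theorem IsLabeledCover.exists_swap_of_agreesBelow {n : ℕ} {u v : Perm' n} {k : Fin n} {b : ℕ}
    (h : IsLabeledCover u v k b) (hv : AgreesBelow v k) (hb : b < (v k : ℕ)) :
    AgreesBelow u k ∧ b = (u k : ℕ) ∧ ∃ l, k < l ∧ u k < u l ∧
      (∀ i : Fin n, k < i → i < l → ¬(u k < u i ∧ u i < u l)) ∧ v = u * Equiv.swap k l := by
  obtain ⟨i, j, hij, huij, hcov, rfl, hik, hkj, rfl⟩ := h
  have hkj' : k < j := hkj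
  have hik' : i = k := by
    by_contra hne
    have hlt : i < k := lt_of_le_of_ne hik hne
    have hk : (u * Equiv.swap i j) k = u k := by
      rw [Equiv.Perm.mul_apply, Equiv.swap_apply_of_ne_of_ne hlt.ne' hkj'.ne]
    have hi : (u * Equiv.swap i j) i = u j := by simp
    have h1 := hv i hlt
    have h2 := hv.apply_le le_rfl
    rw [hi] at h1
    rw [hk] at h2 hb
    rw [Fin.lt_def] at hlt
    exact hcov k hlt hkj' ⟨hb, by rw [Fin.lt_def]; omega⟩
  subst hik'
  refine ⟨fun m hm => ?_, rfl, j, hij, huij, hcov, rfl⟩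
  have hmi : m < i := hm
  have := hv m hm
  rwa [Equiv.Perm.mul_apply, Equiv.swap_apply_of_ne_of_ne hmi.ne (hmi.trans hij).ne] at this

theorem IsLabeledCover.lt {n : ℕ} {u v : Perm' n} {k b : ℕ} (h : IsLabeledCover u v k b) :
    k < n := by
  obtain ⟨_, j, _, _, _, _, _, hkj, _⟩ := h
  exact hkj.trans j.isLt

/-- The smaller value in a cover labeled `(k,b)` ends up in a position after `k`. -/
theorem IsLabeledCover.exists_apply_eq {n : ℕ} {u v : Perm' n} {k b : ℕ}
    (h : IsLabeledCover u v k b) : ∃ j : Fin n, k < j ∧ b = (v j : ℕ) := by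
  obtain ⟨i, j, _, _, _, rfl, _, hkj, rfl⟩ := h
  exact ⟨j, hkj, by simp⟩

/-- If `v` agrees with `w₀` through position `k`, a cover of `v` from below labeled `(k,b)` has
`b < v(k)`. -/
theorem IsLabeledCover.lt_apply {n : ℕ} {u v : Perm' n} {k : Fin n} {b : ℕ}
    (h : IsLabeledCover u v k b) (hv : AgreesBelow v (k + 1)) : b < (v k : ℕ) := by
  obtain ⟨j, hkj, rfl⟩ := h.exists_apply_eq
  have h1 := hv k (Nat.lt_succ_self _)
  have h2 := hv.apply_le hkj
  omega

theorem AgreesBelow.mono {n : ℕ} {u : Perm' n} {k k' : ℕ} (h : AgreesBelow u k) (hk : k' ≤ k) :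
    AgreesBelow u k' :=
  fun i hi => h i (hi.trans_le hk)

/-- Every step of an increasing chain to `w₀` exchanges its label's position, which is the first
defect, with a later one. -/
theorem LabeledChain.Increasing.step_eq {n m : ℕ} {u : Perm' n} {γ : LabeledChain n m u (w0 n)}
    (hγ : γ.Increasing) (t : Fin m) :
    ∃ k : Fin n, (γ.lab t).1 = k ∧ AgreesBelow (γ.c t.castSucc) k ∧
      (γ.lab t).2 = (γ.c t.castSucc k : ℕ) ∧ ∃ l, k < l ∧
        γ.c t.castSucc k < γ.c t.castSucc l ∧
        (∀ i : Fin n, k < i → i < l → ¬(γ.c t.castSucc k < γ.c t.castSucc i ∧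
          γ.c t.castSucc i < γ.c t.castSucc l)) ∧
        γ.c t.succ = γ.c t.castSucc * Equiv.swap k l := by
  induction t using WellFoundedGT.induction with
  | ind t ih =>
    have hstep := γ.step t
    obtain ⟨k, hk⟩ : ∃ k : Fin n, (k : ℕ) = (γ.lab t).1 := ⟨⟨_, hstep.lt⟩, rfl⟩
    rw [← hk] at hstep
    refine ⟨k, hk.symm, ?_⟩
    rcases Nat.lt_or_ge ((t : ℕ) + 1) m with ht | ht
    · let s : Fin m := ⟨t + 1, ht⟩
      have hts : t < s := by simp [s, Fin.lt_def]
      have hcs : γ.c t.succ = γ.c s.castSucc := rfl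
      obtain ⟨k', hk', hagree, hb', -⟩ := ih s hts
      rw [← hcs] at hagree hb'
      rcases hγ t s hts with hlt | ⟨heq, hlt⟩
      · have hagree' := hagree.mono (k' := k + 1) (by omega)
        exact hstep.exists_swap_of_agreesBelow (hagree'.mono (Nat.le_succ _))
          (hstep.lt_apply hagree')
      · obtain rfl : k = k' := Fin.ext (by omega)
        exact hstep.exists_swap_of_agreesBelow hagree (by omega)
    · have hlast : γ.c t.succ = w0 n :=
        (congrArg γ.c (Fin.ext (by simp only [Fin.val_succ, Fin.val_last]; omega))).trans γ.c_last
      have hagree (j : ℕ) : AgreesBelow (γ.c t.succ) j := by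
        rw [hlast]
        exact agreesBelow_w0 j
      exact hstep.exists_swap_of_agreesBelow (hagree _) (hstep.lt_apply (hagree _))

theorem lexLt_trans {p q r : ℕ × ℕ} (hpq : lexLt p q) (hqr : lexLt q r) : lexLt p r := by
  unfold lexLt at *
  omega

/-- The chain with no steps. -/
def LabeledChain.nil {n : ℕ} (u : Perm' n) : LabeledChain n 0 u u where
  c _ := u
  lab := Fin.elim0
  c_zero := rfl
  c_last := rfl
  step i := i.elim0

/-- Prepend a labeled cover to a chain. -/
def LabeledChain.cons {n m : ℕ} {u v w : Perm' n} {k b : ℕ} (h : IsLabeledCover u v k b)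
    (γ : LabeledChain n m v w) : LabeledChain n (m + 1) u w where
  c := Fin.cons u γ.c
  lab := Fin.cons (k, b) γ.lab
  c_zero := rfl
  c_last := γ.c_last
  step i := by
    cases i using Fin.cases with
    | zero => simpa [γ.c_zero] using h
    | succ i => simpa [Fin.castSucc_succ] using γ.step i

theorem LabeledChain.Increasing.cons {n m : ℕ} {u v w : Perm' n} {k b : ℕ}
    (h : IsLabeledCover u v k b) {γ : LabeledChain n m v w} (hγ : γ.Increasing)
    (hlt : ∀ j, lexLt (k, b) (γ.lab j)) : (LabeledChain.cons h γ).Increasing := by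
  intro i j hij
  cases j using Fin.cases with
  | zero => exact absurd hij (Fin.not_lt_zero i)
  | succ j =>
    cases i using Fin.cases with
    | zero => exact hlt j
    | succ i => exact hγ i j (Fin.succ_lt_succ_iff.mp hij)

theorem agreesBelow_mul_swap {n : ℕ} {u : Perm' n} {k l : Fin n} (h : AgreesBelow u k)
    (hkl : k < l) : AgreesBelow (u * Equiv.swap k l) k := by
  intro i hi
  have hik : i < k := hi
  rw [Equiv.Perm.mul_apply, Equiv.swap_apply_of_ne_of_ne hik.ne (hik.trans hkl).ne]
  exact h i hi

/-- If `v` agrees with `w₀` below `k` and `b < v(k)`, there is an increasing chain from `v` to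
`w₀` all of whose labels exceed `(k,b)`. -/
theorem exists_increasing_chain {n : ℕ} (v : Perm' n) (k : Fin n) (b : ℕ)
    (hv : AgreesBelow v k) (hb : b < (v k : ℕ)) :
    ∃ (m : ℕ) (γ : LabeledChain n m v (w0 n)), γ.Increasing ∧ ∀ j, lexLt (k, b) (γ.lab j) := by
  induction hN : n * n - (n * k + b) using Nat.strong_induction_on generalizing v k b with
  | _ N ih =>
    by_cases hw : v = w0 n
    · subst hw
      exact ⟨0, .nil _, fun i => i.elim0, fun i => i.elim0⟩
    obtain ⟨k', hk'⟩ := exists_isFirstDefect hw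
    obtain ⟨l, hkl, hvl, hcov⟩ := hk'.exists_cover
    have hkk' : (k : ℕ) ≤ k' := by
      by_contra hlt
      have h1 := hv k' (not_le.mp hlt)
      have h2 := hk'.1
      omega
    have hlex : lexLt (k, b) (k', (v k' : ℕ)) := by
      rcases hkk'.lt_or_eq with h | h
      · exact Or.inl h
      · obtain rfl := Fin.ext h
        exact Or.inr ⟨rfl, hb⟩
    have hdecr : n * n - (n * k' + (v k' : ℕ)) < N := by
      have h1 : n * (k' + 1) ≤ n * n := Nat.mul_le_mul_left _ k'.isLt
      have h2 := (v k').isLt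
      have h3 := (v k).isLt
      rcases hlex with h | ⟨h, h'⟩
      · have h4 : n * (k + 1) ≤ n * k' := Nat.mul_le_mul_left _ h
        rw [Nat.mul_succ] at h1 h4
        omega
      · simp only at h h'
        rw [← h] at h1 ⊢
        rw [Nat.mul_succ] at h1
        omega
    obtain ⟨m, γ, hγ, hlt⟩ := ih _ hdecr (v * Equiv.swap k' l) k' (v k')
      (agreesBelow_mul_swap hk'.agreesBelow hkl) (by simpa using hvl) rfl
    have hstep : IsLabeledCover v (v * Equiv.swap k' l) k' (v k') :=
      ⟨k', l, hkl, hvl, hcov, rfl, le_rfl, hkl, rfl⟩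
    refine ⟨m + 1, .cons hstep γ, hγ.cons hstep hlt, fun j => ?_⟩
    cases j using Fin.cases with
    | zero => exact hlex
    | succ j => exact lexLt_trans hlex (hlt j)

/-- For `u ≠ w₀`, the first edge of any increasing chain from `u` to
`w₀` is `u →^{(k, u(k))} u·(k,l)` with `l > k`, where `k` is the minimal position `i`
with `u(i) + i < n + 1` (0-indexed: `u(i) + i + 2 ≤ n`); more precisely, the possible
first steps are exactly the covers `u ⋖ u·(k,l)` with this `k`, `b = u(k)`, `l > k`,
`u(l) > u(k)` and no intermediate value between `u(k)` and `u(l)`. -/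
theorem first_step_of_increasing_chain (n : ℕ) (u : Perm' n) (hu : u ≠ w0 n) :
    (∀ (m : ℕ) (γ : LabeledChain n m u (w0 n)), γ.Increasing →
      0 < m ∧ ∀ hm : 0 < m,
        ∃ k : Fin n,
          ((k : ℕ) + (u k : ℕ) + 2 ≤ n ∧
            ∀ i : Fin n, (i : ℕ) + (u i : ℕ) + 2 ≤ n → k ≤ i) ∧
          (γ.lab ⟨0, hm⟩).1 = (k : ℕ) ∧ (γ.lab ⟨0, hm⟩).2 = (u k : ℕ) ∧
          ∃ l : Fin n, k < l ∧ γ.c ⟨1, by omega⟩ = u * Equiv.swap k l) ∧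
    (∀ (k b : ℕ) (v : Perm' n),
      (∃ (m : ℕ) (γ : LabeledChain n m u (w0 n)) (hm : 0 < m), γ.Increasing ∧
        γ.lab ⟨0, hm⟩ = (k, b) ∧ γ.c ⟨1, by omega⟩ = v) ↔
      (∃ kk l : Fin n, (kk : ℕ) = k ∧
        ((kk : ℕ) + (u kk : ℕ) + 2 ≤ n ∧
          ∀ i : Fin n, (i : ℕ) + (u i : ℕ) + 2 ≤ n → kk ≤ i) ∧
        b = (u kk : ℕ) ∧ kk < l ∧ u kk < u l ∧
        (∀ i : Fin n, kk < i → i < l → ¬(u kk < u i ∧ u i < u l)) ∧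
        v = u * Equiv.swap kk l)) := by
  have first {m : ℕ} (γ : LabeledChain n m u (w0 n)) (hγ : γ.Increasing) (hm : 0 < m) :
      ∃ k l : Fin n, IsFirstDefect u k ∧ (γ.lab ⟨0, hm⟩).1 = (k : ℕ) ∧
        (γ.lab ⟨0, hm⟩).2 = (u k : ℕ) ∧ k < l ∧ u k < u l ∧
        (∀ i : Fin n, k < i → i < l → ¬(u k < u i ∧ u i < u l)) ∧
        γ.c ⟨1, by omega⟩ = u * Equiv.swap k l := by
    obtain ⟨k, hk, hagree, hb, l, hkl, hul, hcov, hc⟩ := hγ.step_eq ⟨0, hm⟩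
    have h0 : γ.c (Fin.castSucc ⟨0, hm⟩) = u := γ.c_zero
    rw [h0] at hagree hb hul hcov hc
    exact ⟨k, l, hagree.isFirstDefect hkl hul, hk, hb, hkl, hul, hcov, hc⟩
  refine ⟨fun m γ hγ => ⟨Nat.pos_of_ne_zero ?_, fun hm => ?_⟩, fun k b v => ⟨?_, ?_⟩⟩
  · rintro rfl
    exact hu (γ.c_zero.symm.trans γ.c_last)
  · obtain ⟨k, l, hk, h1, h2, hkl, -, -, hc⟩ := first γ hγ hm
    exact ⟨k, hk, h1, h2, l, hkl, hc⟩
  · rintro ⟨m, γ, hm, hγ, hlab, rfl⟩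
    obtain ⟨k', l, hk, h1, h2, hkl, hul, hcov, hc⟩ := first γ hγ hm
    rw [hlab] at h1 h2
    exact ⟨k', l, h1.symm, hk, h2, hkl, hul, hcov, hc⟩
  · rintro ⟨k', l, rfl, hk, rfl, hkl, hul, hcov, rfl⟩
    have hagree : AgreesBelow u k' := IsFirstDefect.agreesBelow hk
    obtain ⟨m, γ, hγ, hlt⟩ := exists_increasing_chain (u * Equiv.swap k' l) k' (u k')
      (agreesBelow_mul_swap hagree hkl) (by simpa using hul)
    have hstep : IsLabeledCover u (u * Equiv.swap k' l) k' (u k') :=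
      ⟨k', l, hkl, hul, hcov, rfl, le_rfl, hkl, rfl⟩
    exact ⟨m + 1, .cons hstep γ, Nat.succ_pos m, hγ.cons hstep hlt, rfl, γ.c_zero⟩
end
end

section
/- Let u ≤ w be permutations in Σ_n (Bruhat order). Then every coefficient of the skew Schubert polynomial S_{w/u} ∈ ℤ[x₁,…,x_n] is a nonnegative integer. -/
open MvPolynomial

noncomputable section

namespace SkewSchubert

section Swap

variable {R : Type*} [CommRing R]

/-- The action of the adjacent transposition `(i, i+1)` on polynomials. -/
def swapHom (R : Type*) [CommRing R] (i : ℕ) : MvPolynomial ℕ R →ₐ[R] MvPolynomial ℕ R :=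
  rename (Equiv.swap i (i + 1))

lemma swapHom_X_left (i : ℕ) : swapHom R i (X i) = X (i + 1) := by
  simp [swapHom]

lemma swapHom_X_right (i : ℕ) : swapHom R i (X (i + 1)) = X i := by
  simp [swapHom]

lemma swapHom_X_of_ne {i k : ℕ} (h : k ≠ i) (h' : k ≠ i + 1) :
    swapHom R i (X k) = X k := by
  simp [swapHom, Equiv.swap_apply_of_ne_of_ne h h']

lemma swapHom_C (i : ℕ) (a : R) : swapHom R i (C a) = C a := by
  simp [swapHom]

lemma swapHom_swapHom (i : ℕ) (f : MvPolynomial ℕ R) : swapHom R i (swapHom R i f) = f := by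
  simp only [swapHom, rename_rename, ← Equiv.coe_trans, Equiv.swap_swap, Equiv.coe_refl, rename_id,
    AlgHom.id_apply]

lemma constantCoeff_swapHom (i : ℕ) (f : MvPolynomial ℕ R) :
    constantCoeff (swapHom R i f) = constantCoeff f :=
  constantCoeff_rename _ _

lemma swapHom_comm {i j : ℕ} (h : i + 1 < j) (f : MvPolynomial ℕ R) :
    swapHom R i (swapHom R j f) = swapHom R j (swapHom R i f) := by
  simp only [swapHom, rename_rename]
  congr 2
  ext k
  simp only [Function.comp_apply, Equiv.swap_apply_def]
  split_ifs <;> omega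

lemma swapHom_braid (i : ℕ) (f : MvPolynomial ℕ R) :
    swapHom R i (swapHom R (i + 1) (swapHom R i f)) =
      swapHom R (i + 1) (swapHom R i (swapHom R (i + 1) f)) := by
  simp only [swapHom, rename_rename]
  congr 2
  ext k
  simp only [Function.comp_apply, Equiv.swap_apply_def]
  split_ifs <;> omega

lemma exists_mul_eq_sub_swapHom (i : ℕ) (f : MvPolynomial ℕ R) :
    ∃ g, (X i - X (i + 1)) * g = f - swapHom R i f := by
  induction f using MvPolynomial.induction_on with
  | C a => exact ⟨0, by rw [swapHom_C, sub_self, mul_zero]⟩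
  | add p q hp hq =>
    obtain ⟨a, ha⟩ := hp
    obtain ⟨b, hb⟩ := hq
    exact ⟨a + b, by rw [map_add]; linear_combination ha + hb⟩
  | mul_X p k hp =>
    obtain ⟨a, ha⟩ := hp
    rw [map_mul]
    by_cases h : k = i
    · subst h
      exact ⟨a * X k + swapHom R k p, by rw [swapHom_X_left]; linear_combination X k * ha⟩
    by_cases h' : k = i + 1
    · subst h'
      exact ⟨a * X (i + 1) - swapHom R i p, by
        rw [swapHom_X_right]; linear_combination X (i + 1) * ha⟩
    · exact ⟨a * X k, by rw [swapHom_X_of_ne h h']; linear_combination X k * ha⟩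

/-- The product `∏ (c - xₗ)` over `l ∈ A`. -/
def rootProd (c : R) (A : Finset ℕ) : MvPolynomial ℕ R := ∏ l ∈ A, (C c - X l)

lemma swapHom_rootProd {c : R} {A : Finset ℕ} {i : ℕ} (h : i ∈ A ↔ i + 1 ∈ A) :
    swapHom R i (rootProd c A) = rootProd c A := by
  rw [rootProd, map_prod]
  refine Finset.prod_equiv (Equiv.swap i (i + 1)) (fun k => ?_) fun k _ => ?_
  · rw [Equiv.swap_apply_def]
    split_ifs with h₁ h₂
    · rw [h₁, h]
    · rw [h₂, h]
    · rfl
  · rw [map_sub, swapHom_C, swapHom, rename_X]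

end Swap

section DividedDifference

variable {R : Type*} [CommRing R] [IsDomain R]

lemma X_sub_X_ne_zero {i j : ℕ} (h : i ≠ j) : (X i - X j : MvPolynomial ℕ R) ≠ 0 :=
  sub_ne_zero.2 fun e => h (X_injective e)

/-- The divided difference operator `∂ᵢ`. -/
def divDiff (R : Type*) [CommRing R] [IsDomain R] (i : ℕ) :
    MvPolynomial ℕ R →ₗ[R] MvPolynomial ℕ R where
  toFun f := (exists_mul_eq_sub_swapHom i f).choose
  map_add' f g := by
    apply mul_left_cancel₀ (X_sub_X_ne_zero (R := R) (Nat.succ_ne_self i).symm)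
    rw [mul_add, (exists_mul_eq_sub_swapHom i f).choose_spec,
      (exists_mul_eq_sub_swapHom i g).choose_spec,
      (exists_mul_eq_sub_swapHom i (f + g)).choose_spec, map_add]
    ring
  map_smul' a f := by
    apply mul_left_cancel₀ (X_sub_X_ne_zero (R := R) (Nat.succ_ne_self i).symm)
    rw [RingHom.id_apply, mul_smul_comm, (exists_mul_eq_sub_swapHom i f).choose_spec,
      (exists_mul_eq_sub_swapHom i (a • f)).choose_spec, map_smul, smul_sub]

lemma mul_divDiff (i : ℕ) (f : MvPolynomial ℕ R) :
    (X i - X (i + 1)) * divDiff R i f = f - swapHom R i f :=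
  (exists_mul_eq_sub_swapHom i f).choose_spec

lemma divDiff_unique {i : ℕ} {f g : MvPolynomial ℕ R}
    (h : (X i - X (i + 1)) * g = f - swapHom R i f) : divDiff R i f = g :=
  mul_left_cancel₀ (X_sub_X_ne_zero (R := R) (Nat.succ_ne_self i).symm)
    ((mul_divDiff i f).trans h.symm)

lemma divDiff_mul (i : ℕ) (f g : MvPolynomial ℕ R) :
    divDiff R i (f * g) = divDiff R i f * swapHom R i g + f * divDiff R i g :=
  divDiff_unique (by
    rw [map_mul]
    linear_combination swapHom R i g * mul_divDiff i f + f * mul_divDiff i g)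

lemma divDiff_eq_zero {i : ℕ} {f : MvPolynomial ℕ R} (h : swapHom R i f = f) :
    divDiff R i f = 0 :=
  divDiff_unique (by rw [h]; ring)

lemma swapHom_eq_of_divDiff_eq_zero {i : ℕ} {f : MvPolynomial ℕ R} (h : divDiff R i f = 0) :
    swapHom R i f = f := by
  have := mul_divDiff i f
  rw [h, mul_zero] at this
  exact (sub_eq_zero.1 this.symm).symm

lemma swapHom_divDiff (i : ℕ) (f : MvPolynomial ℕ R) :
    swapHom R i (divDiff R i f) = divDiff R i f := by
  apply mul_left_cancel₀ (X_sub_X_ne_zero (R := R) (Nat.succ_ne_self i).symm)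
  have h := congrArg (swapHom R i) (mul_divDiff i f)
  simp only [map_mul, map_sub, swapHom_X_left, swapHom_X_right, swapHom_swapHom] at h
  linear_combination -h - mul_divDiff i f

lemma divDiff_divDiff (i : ℕ) (f : MvPolynomial ℕ R) : divDiff R i (divDiff R i f) = 0 :=
  divDiff_eq_zero (swapHom_divDiff i f)

lemma divDiff_symm_mul {i : ℕ} {e : MvPolynomial ℕ R} (h : swapHom R i e = e)
    (f : MvPolynomial ℕ R) : divDiff R i (e * f) = e * divDiff R i f := by
  rw [divDiff_mul, divDiff_eq_zero h, zero_mul, zero_add]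

lemma divDiff_C (i : ℕ) (a : R) : divDiff R i (C a) = 0 :=
  divDiff_eq_zero (swapHom_C i a)

lemma divDiff_X_right (i : ℕ) : divDiff R i (X (i + 1)) = -1 :=
  divDiff_unique (by rw [swapHom_X_right]; ring)

lemma divDiff_C_sub_X (i : ℕ) (c : R) : divDiff R i (C c - X (i + 1)) = 1 := by
  rw [map_sub, divDiff_C, divDiff_X_right, zero_sub, neg_neg]

lemma swapHom_divDiff_of_lt {i j : ℕ} (h : i + 1 < j) (f : MvPolynomial ℕ R) :
    swapHom R i (divDiff R j f) = divDiff R j (swapHom R i f) := by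
  refine (divDiff_unique ?_).symm
  have := congrArg (swapHom R i) (mul_divDiff j f)
  rw [map_mul, map_sub, map_sub, swapHom_X_of_ne (by omega) (by omega),
    swapHom_X_of_ne (by omega) (by omega), swapHom_comm h] at this
  exact this

lemma divDiff_comm {i j : ℕ} (h : i + 1 < j) (f : MvPolynomial ℕ R) :
    divDiff R i (divDiff R j f) = divDiff R j (divDiff R i f) := by
  refine divDiff_unique ?_
  have hs : swapHom R j (X i - X (i + 1) : MvPolynomial ℕ R) = X i - X (i + 1) := by
    rw [map_sub, swapHom_X_of_ne (by omega) (by omega), swapHom_X_of_ne (by omega) (by omega)]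
  rw [← divDiff_symm_mul hs, mul_divDiff, map_sub, swapHom_divDiff_of_lt h]

lemma divDiff_braid (i : ℕ) (f : MvPolynomial ℕ R) :
    divDiff R i (divDiff R (i + 1) (divDiff R i f)) =
      divDiff R (i + 1) (divDiff R i (divDiff R (i + 1) f)) := by
  have hab : (X i - X (i + 1) : MvPolynomial ℕ R) ≠ 0 := X_sub_X_ne_zero (by omega)
  have hbc : (X (i + 1) - X (i + 2) : MvPolynomial ℕ R) ≠ 0 := X_sub_X_ne_zero (by omega)
  have hac : (X i - X (i + 2) : MvPolynomial ℕ R) ≠ 0 := X_sub_X_ne_zero (by omega)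
  have sc : swapHom R i (X (i + 2)) = X (i + 2) := swapHom_X_of_ne (by omega) (by omega)
  have ta : swapHom R (i + 1) (X i) = X i := swapHom_X_of_ne (by omega) (by omega)
  have tb : swapHom R (i + 1) (X (i + 1)) = X (i + 2) := swapHom_X_left _
  have tc : swapHom R (i + 1) (X (i + 2)) = X (i + 1) := swapHom_X_right _
  set g := divDiff R i f with hg
  set h := divDiff R (i + 1) g with hh
  set g' := divDiff R (i + 1) f with hg'
  set h' := divDiff R i g' with hh'
  have e1 := mul_divDiff i h
  have e2 : (X (i + 1) - X (i + 2)) * h = _ := mul_divDiff (i + 1) g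
  have e3 := congrArg (swapHom R i) e2
  have e4 := mul_divDiff i f
  have e5 := congrArg (swapHom R (i + 1)) e4
  have e6 := congrArg (swapHom R i) e5
  have e1' : (X (i + 1) - X (i + 2)) * divDiff R (i + 1) h' = _ := mul_divDiff (i + 1) h'
  have e2' := mul_divDiff i g'
  have e3' := congrArg (swapHom R (i + 1)) e2'
  have e4' : (X (i + 1) - X (i + 2)) * g' = _ := mul_divDiff (i + 1) f
  have e5' := congrArg (swapHom R i) e4'
  have e6' := congrArg (swapHom R (i + 1)) e5'
  rw [← hg] at e4 e5 e6
  rw [← hh'] at e2' e3'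
  simp only [map_mul, map_sub, swapHom_X_left, swapHom_X_right, sc, ta, tb, tc]
    at e3 e5 e6 e3' e5' e6'
  rw [show swapHom R i g = g from swapHom_divDiff _ _] at e3
  rw [show swapHom R (i + 1) g' = g' from swapHom_divDiff _ _] at e3'
  rw [swapHom_braid] at e6
  apply mul_left_cancel₀ (mul_ne_zero (mul_ne_zero hab hbc) hac)
  linear_combination (X (i + 1) - X (i + 2)) * (X i - X (i + 2)) * e1
    + (X i - X (i + 2)) * e2 - (X (i + 1) - X (i + 2)) * e3 + e4 - e5 + e6
    - ((X i - X (i + 1)) * (X i - X (i + 2)) * e1'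
    + (X i - X (i + 2)) * e2' - (X i - X (i + 1)) * e3' + e4' - e5' + e6')

end DividedDifference

section LongestElement

variable {R : Type*} [CommRing R] [IsDomain R]

/-- The composite `∂ⱼ ∂ⱼ₊₁ ⋯ ∂ⱼ₊ᵣ₋₁`, in which `∂ⱼ₊ᵣ₋₁` acts first. -/
def rowUp (R : Type*) [CommRing R] [IsDomain R] :
    ℕ → ℕ → MvPolynomial ℕ R →ₗ[R] MvPolynomial ℕ R
  | 0, _ => LinearMap.id
  | r + 1, j => divDiff R j ∘ₗ rowUp R r (j + 1)

/-- The composite `∂ⱼ₊ᵣ₋₁ ⋯ ∂ⱼ₊₁ ∂ⱼ`, in which `∂ⱼ` acts first. -/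
def rowDown (R : Type*) [CommRing R] [IsDomain R] :
    ℕ → ℕ → MvPolynomial ℕ R →ₗ[R] MvPolynomial ℕ R
  | 0, _ => LinearMap.id
  | r + 1, j => rowDown R r (j + 1) ∘ₗ divDiff R j

/-- The divided difference operator of the longest permutation of the `r + 1` variables
`xⱼ, …, xⱼ₊ᵣ`. -/
def longDiff (R : Type*) [CommRing R] [IsDomain R] :
    ℕ → ℕ → MvPolynomial ℕ R →ₗ[R] MvPolynomial ℕ R
  | 0, _ => LinearMap.id
  | r + 1, j => longDiff R r (j + 1) ∘ₗ rowUp R (r + 1) j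

lemma rowUp_succ (r j : ℕ) (f : MvPolynomial ℕ R) :
    rowUp R (r + 1) j f = divDiff R j (rowUp R r (j + 1) f) := rfl

lemma rowDown_succ (r j : ℕ) (f : MvPolynomial ℕ R) :
    rowDown R (r + 1) j f = rowDown R r (j + 1) (divDiff R j f) := rfl

lemma longDiff_succ (r j : ℕ) (f : MvPolynomial ℕ R) :
    longDiff R (r + 1) j f = longDiff R r (j + 1) (rowUp R (r + 1) j f) := rfl

lemma rowUp_succ' (r j : ℕ) (f : MvPolynomial ℕ R) :
    rowUp R (r + 1) j f = rowUp R r j (divDiff R (j + r) f) := by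
  induction r generalizing j with
  | zero => rfl
  | succ r ih => rw [rowUp_succ, ih, rowUp_succ, add_right_comm, add_assoc j]

lemma rowDown_succ' (r j : ℕ) (f : MvPolynomial ℕ R) :
    rowDown R (r + 1) j f = divDiff R (j + r) (rowDown R r j f) := by
  induction r generalizing j f with
  | zero => rfl
  | succ r ih => rw [rowDown_succ, ih, rowDown_succ, add_right_comm, add_assoc j]

lemma divDiff_rowUp_of_lt {i j : ℕ} (h : i + 1 < j) (r : ℕ) (f : MvPolynomial ℕ R) :
    divDiff R i (rowUp R r j f) = rowUp R r j (divDiff R i f) := by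
  induction r generalizing j with
  | zero => rfl
  | succ r ih => rw [rowUp_succ, divDiff_comm h, ih (by omega), rowUp_succ]

lemma divDiff_succ_rowUp {i j r : ℕ} (h : j ≤ i) (h' : i + 1 < j + r) (f : MvPolynomial ℕ R) :
    divDiff R (i + 1) (rowUp R r j f) = rowUp R r j (divDiff R i f) := by
  induction r generalizing j with
  | zero => omega
  | succ r ih =>
    rcases h.lt_or_eq with hlt | rfl
    · rw [rowUp_succ, ← divDiff_comm (by omega), ih hlt (by omega), rowUp_succ]
    · obtain ⟨r, rfl⟩ : ∃ s, r = s + 1 := ⟨r - 1, by omega⟩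
      rw [rowUp_succ, rowUp_succ, ← divDiff_braid, divDiff_rowUp_of_lt (by omega), rowUp_succ,
        rowUp_succ]

lemma longDiff_eq_zero {i j r : ℕ} (h : j ≤ i) (h' : i < j + r) {f : MvPolynomial ℕ R}
    (hf : swapHom R i f = f) : longDiff R r j f = 0 := by
  induction r generalizing i j f with
  | zero => omega
  | succ r ih =>
    rw [longDiff_succ]
    rcases (show i < j + r ∨ i = j + r by omega) with hlt | rfl
    · refine ih (i := i + 1) (by omega) (by omega) (swapHom_eq_of_divDiff_eq_zero ?_)
      rw [divDiff_succ_rowUp h (by omega), divDiff_eq_zero hf, map_zero]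
    · rw [rowUp_succ', divDiff_eq_zero hf, map_zero, map_zero]

/-- Divided differences are self-adjoint for the pairing defined by `longDiff`. -/
lemma longDiff_divDiff_mul {i j r : ℕ} (h : j ≤ i) (h' : i < j + r) (f g : MvPolynomial ℕ R) :
    longDiff R r j (divDiff R i f * g) = longDiff R r j (f * divDiff R i g) := by
  rw [← sub_eq_zero, ← map_sub]
  refine longDiff_eq_zero h h' ?_
  apply mul_left_cancel₀ (X_sub_X_ne_zero (R := R) (Nat.succ_ne_self i).symm)
  rw [map_sub, map_mul, map_mul, swapHom_divDiff, swapHom_divDiff]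
  linear_combination (swapHom R i g - g) * mul_divDiff i f + (f - swapHom R i f) * mul_divDiff i g

lemma rowUp_symm_mul {j r : ℕ} {e : MvPolynomial ℕ R}
    (he : ∀ i, j ≤ i → i < j + r → swapHom R i e = e) (f : MvPolynomial ℕ R) :
    rowUp R r j (e * f) = e * rowUp R r j f := by
  induction r generalizing j with
  | zero => rfl
  | succ r ih =>
    rw [rowUp_succ, ih fun i _ _ => he i (by omega) (by omega),
      divDiff_symm_mul (he j le_rfl (by omega)), rowUp_succ]

lemma rowDown_symm_mul {j r : ℕ} {e : MvPolynomial ℕ R}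
    (he : ∀ i, j ≤ i → i < j + r → swapHom R i e = e) (f : MvPolynomial ℕ R) :
    rowDown R r j (e * f) = e * rowDown R r j f := by
  induction r generalizing j f with
  | zero => rfl
  | succ r ih =>
    rw [rowDown_succ, divDiff_symm_mul (he j le_rfl (by omega)),
      ih fun i _ _ => he i (by omega) (by omega), rowDown_succ]

lemma longDiff_symm_mul {j r : ℕ} {e : MvPolynomial ℕ R}
    (he : ∀ i, j ≤ i → i < j + r → swapHom R i e = e) (f : MvPolynomial ℕ R) :
    longDiff R r j (e * f) = e * longDiff R r j f := by
  induction r generalizing j f with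
  | zero => rfl
  | succ r ih =>
    rw [longDiff_succ, rowUp_symm_mul he, ih fun i _ _ => he i (by omega) (by omega),
      longDiff_succ]

lemma divDiff_longDiff_of_lt {i j : ℕ} (h : i + 1 < j) (r : ℕ) (f : MvPolynomial ℕ R) :
    divDiff R i (longDiff R r j f) = longDiff R r j (divDiff R i f) := by
  induction r generalizing j f with
  | zero => rfl
  | succ r ih =>
    rw [longDiff_succ, ih (by omega), divDiff_rowUp_of_lt h, longDiff_succ]

lemma longDiff_succ' (r j : ℕ) (f : MvPolynomial ℕ R) :
    longDiff R (r + 1) j f = rowDown R (r + 1) j (longDiff R r (j + 1) f) := by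
  induction r generalizing j f with
  | zero => rfl
  | succ r ih =>
    rw [longDiff_succ, ih, rowUp_succ, ← divDiff_longDiff_of_lt (by omega), ← rowDown_succ,
      ← longDiff_succ]

lemma rowDown_X_pow {j r d : ℕ} (h : d ≤ r) :
    rowDown R r j (X j ^ d) = if d = r then 1 else 0 := by
  induction r generalizing j d with
  | zero => obtain rfl : d = 0 := by omega
            simp [rowDown]
  | succ r ih =>
    have key : divDiff R j (X j ^ d) =
        ∑ e ∈ Finset.range d, X j ^ (d - 1 - e) * X (j + 1) ^ e := by
      refine divDiff_unique ?_
      rw [map_pow, swapHom_X_left, ← (Commute.all (X j) (X (j + 1))).mul_geom_sum₂ d,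
        ← Finset.sum_range_reflect]
      congr 1
      refine Finset.sum_congr rfl fun e he => ?_
      rw [Finset.mem_range] at he
      rw [show d - 1 - (d - 1 - e) = e by omega]
    have term (e : ℕ) (he : e ∈ Finset.range d) :
        rowDown R r (j + 1) (X j ^ (d - 1 - e) * X (j + 1) ^ e) =
          X j ^ (d - 1 - e) * if e = r then 1 else 0 := by
      rw [Finset.mem_range] at he
      rw [rowDown_symm_mul, ih (by omega)]
      intro i hi _
      rw [map_pow, swapHom_X_of_ne (by omega) (by omega)]
    rw [rowDown_succ, key, map_sum, Finset.sum_congr rfl term]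
    split_ifs with hd
    · subst hd
      rw [Finset.sum_eq_single r]
      · simp
      · intro e _ he
        rw [if_neg he, mul_zero]
      · simp
    · refine Finset.sum_eq_zero fun e he => ?_
      rw [Finset.mem_range] at he
      rw [if_neg (by omega), mul_zero]

lemma rowDown_rootProd (c : R) (r j : ℕ) :
    rowDown R r j (rootProd c (Finset.Ioc j (j + r))) = 1 := by
  induction r generalizing j with
  | zero => simp [rowDown, rootProd]
  | succ r ih =>
    have hI : Finset.Ioc j (j + (r + 1)) = insert (j + 1) (Finset.Ioc (j + 1) (j + 1 + r)) := by
      ext k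
      simp only [Finset.mem_Ioc, Finset.mem_insert]
      omega
    rw [rowDown_succ, hI, rootProd, Finset.prod_insert (by simp), ← rootProd, mul_comm,
      divDiff_symm_mul (swapHom_rootProd (by simp)), divDiff_C_sub_X, mul_one, ih]

lemma rowDown_X_pow_mul_rootProd (c : R) {r d : ℕ} (j : ℕ) (h : d ≤ r) :
    rowDown R r j (X j ^ d * rootProd c (Finset.Ioc j (j + r))) = C c ^ d := by
  induction d with
  | zero => rw [pow_zero, one_mul, rowDown_rootProd, pow_zero]
  | succ d ih =>
    have hI : Finset.Icc j (j + r) = insert j (Finset.Ioc j (j + r)) := by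
      ext k
      simp only [Finset.mem_Ioc, Finset.mem_insert, Finset.mem_Icc]
      omega
    have e : X j ^ (d + 1) * rootProd c (Finset.Ioc j (j + r)) =
        C c * (X j ^ d * rootProd c (Finset.Ioc j (j + r))) -
          rootProd c (Finset.Icc j (j + r)) * X j ^ d := by
      rw [hI, rootProd, rootProd, Finset.prod_insert (by simp)]
      ring
    rw [e, map_sub, ← smul_eq_C_mul, map_smul, ih (by omega), rowDown_symm_mul,
      rowDown_X_pow (by omega), if_neg (by omega), smul_eq_C_mul, mul_zero, sub_zero, pow_succ']
    intro i _ _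
    refine swapHom_rootProd ?_
    simp only [Finset.mem_Icc]
    omega

/-- The reproducing property of the kernel `∏_{k < l} (c k - x l)`. -/
lemma longDiff_mul_kernel (c : ℕ → R) (d : ℕ → ℕ) (r j : ℕ)
    (hd : ∀ k ∈ Finset.Icc j (j + r), k + d k ≤ j + r) :
    longDiff R r j (∏ k ∈ Finset.Icc j (j + r),
      (X k ^ d k * rootProd (c k) (Finset.Ioc k (j + r)))) =
      C (∏ k ∈ Finset.Icc j (j + r), c k ^ d k) := by
  induction r generalizing j with
  | zero =>
    have := hd j (by simp)
    simp [longDiff, rootProd, show d j = 0 by omega]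
  | succ r ih =>
    have hI : Finset.Icc j (j + (r + 1)) = insert j (Finset.Icc (j + 1) (j + 1 + r)) := by
      ext k
      simp only [Finset.mem_insert, Finset.mem_Icc]
      omega
    have hdj := hd j (by simp)
    rw [hI, Finset.prod_insert (by simp), Finset.prod_insert (by simp), longDiff_succ',
      longDiff_symm_mul, show j + (r + 1) = j + 1 + r by omega, ih]
    · rw [mul_comm (X j ^ d j * _), ← smul_eq_C_mul, map_smul, show j + 1 + r = j + (r + 1) by omega,
        rowDown_X_pow_mul_rootProd _ _ (by omega), smul_eq_C_mul, map_mul, map_pow, mul_comm]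
    · intro k hk
      rw [Finset.mem_Icc] at hk
      have := hd k (Finset.mem_Icc.2 (by omega))
      omega
    · intro i _ _
      rw [map_mul, map_pow, swapHom_X_of_ne (by omega) (by omega), swapHom_rootProd]
      simp only [Finset.mem_Ioc]
      omega

lemma longDiff_staircase (r j : ℕ) :
    longDiff R r j (∏ k ∈ Finset.Icc j (j + r), X k ^ (j + r - k)) = 1 := by
  induction r generalizing j with
  | zero => simp [longDiff]
  | succ r ih =>
    have hI : Finset.Icc j (j + (r + 1)) = insert j (Finset.Icc (j + 1) (j + 1 + r)) := by
      ext k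
      simp only [Finset.mem_insert, Finset.mem_Icc]
      omega
    rw [hI, Finset.prod_insert (by simp), longDiff_succ', longDiff_symm_mul,
      show j + (r + 1) = j + 1 + r by omega, ih, mul_one, rowDown_X_pow (by omega),
      if_pos (by omega)]
    intro i _ _
    rw [map_pow, swapHom_X_of_ne (by omega) (by omega)]

end LongestElement

section Staircase

variable {R : Type*} [CommRing R]

/-- The ideal of polynomials without constant term. -/
abbrev augIdeal (R : Type*) [CommRing R] : Ideal (MvPolynomial ℕ R) :=
  RingHom.ker (constantCoeff : MvPolynomial ℕ R →+* R)

/-- The staircase monomial in the variables `x₀, …, xᵣ`. -/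
def staircase (R : Type*) [CommRing R] (r : ℕ) : MvPolynomial ℕ R :=
  ∏ k ∈ Finset.range (r + 1), X k ^ (r - k)

lemma staircase_mem_augIdeal_pow (r : ℕ) :
    staircase R r ∈ augIdeal R ^ ∑ k ∈ Finset.range (r + 1), k := by
  rw [← Finset.sum_range_reflect, staircase, ← Finset.prod_pow_eq_pow_sum]
  refine Ideal.prod_mem_prod fun k _ => ?_
  simpa using Ideal.pow_mem_pow (show X k ∈ augIdeal R by simp) (r - k)

end Staircase

section Order

variable {R : Type*} [CommRing R] [IsDomain R]

lemma divDiff_mem_augIdeal_pow (i d : ℕ) {f : MvPolynomial ℕ R} (hf : f ∈ augIdeal R ^ (d + 1)) :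
    divDiff R i f ∈ augIdeal R ^ d := by
  induction d generalizing f with
  | zero => simp
  | succ d ih =>
    rw [pow_succ'] at hf
    refine Submodule.mul_induction_on hf (fun a ha b hb => ?_) fun a b ha hb => ?_
    · rw [mul_comm, divDiff_mul]
      refine Ideal.add_mem _ ?_ (Ideal.mul_mem_right _ _ hb)
      rw [pow_succ]
      refine Ideal.mul_mem_mul (ih hb) ?_
      rwa [RingHom.mem_ker, constantCoeff_swapHom]
    · rw [map_add]
      exact Ideal.add_mem _ ha hb

lemma rowUp_mem_augIdeal_pow (r j d : ℕ) {f : MvPolynomial ℕ R}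
    (hf : f ∈ augIdeal R ^ (d + r)) : rowUp R r j f ∈ augIdeal R ^ d := by
  induction r generalizing j d with
  | zero => exact hf
  | succ r ih =>
    rw [rowUp_succ]
    exact divDiff_mem_augIdeal_pow _ _ (ih _ _ (by rwa [add_assoc, add_comm 1]))

lemma longDiff_mem_augIdeal_pow (r j d : ℕ) {f : MvPolynomial ℕ R}
    (hf : f ∈ augIdeal R ^ (d + ∑ k ∈ Finset.range (r + 1), k)) :
    longDiff R r j f ∈ augIdeal R ^ d := by
  induction r generalizing j d f with
  | zero => simpa [longDiff] using hf
  | succ r ih =>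
    rw [longDiff_succ]
    refine ih _ _ (rowUp_mem_augIdeal_pow _ _ _ ?_)
    rwa [add_assoc, ← Finset.sum_range_succ]

lemma longDiff_staircase_zero (r : ℕ) : longDiff R r 0 (staircase R r) = 1 := by
  have := longDiff_staircase (R := R) r 0
  rwa [zero_add, ← Nat.range_succ_eq_Icc_zero] at this

lemma constantCoeff_longDiff_staircase (r : ℕ) (f : MvPolynomial ℕ R) :
    constantCoeff (longDiff R r 0 (f * staircase R r)) = constantCoeff f := by
  have h : longDiff R r 0 ((f - C (constantCoeff f)) * staircase R r) ∈ augIdeal R ^ 1 := by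
    refine longDiff_mem_augIdeal_pow _ _ _ ?_
    rw [pow_add, pow_one]
    exact Ideal.mul_mem_mul (by simp) (staircase_mem_augIdeal_pow r)
  rw [pow_one, RingHom.mem_ker, sub_mul, map_sub, map_sub, ← smul_eq_C_mul, map_smul,
    longDiff_staircase_zero, sub_eq_zero] at h
  simpa using h

end Order

section Permutations

variable {n : ℕ}

/-- The adjacent transposition `(i, i+1)` of `Fin n`. -/
abbrev adj (i : ℕ) (h : i + 1 < n) : Perm' n :=
  Equiv.swap (⟨i, by omega⟩ : Fin n) ⟨i + 1, h⟩

lemma adj_apply_val (i : ℕ) (h : i + 1 < n) (k : Fin n) :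
    (adj i h k : ℕ) = Equiv.swap i (i + 1) (k : ℕ) := by
  simp only [adj, Equiv.swap_apply_def, Fin.ext_iff]
  split_ifs <;> rfl

lemma invLength_lt_mul_adj (v : Perm' n) (i : ℕ) (h : i + 1 < n)
    (hv : v ⟨i, by omega⟩ < v ⟨i + 1, h⟩) : invLength v < invLength (v * adj i h) := by
  have hs (k : Fin n) : adj i h (adj i h k) = k := Equiv.swap_apply_self _ _ _
  unfold invLength
  rw [← Finset.card_map ((adj i h).prodCongr (adj i h)).toEmbedding]
  apply Finset.card_lt_card
  rw [Finset.ssubset_iff_of_subset]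
  · refine ⟨(⟨i, by omega⟩, ⟨i + 1, h⟩), ?_, ?_⟩
    · refine Finset.mem_filter.2 ⟨Finset.mem_univ _, by simp [Fin.lt_def], ?_⟩
      change v (adj i h ⟨i + 1, h⟩) < v (adj i h ⟨i, by omega⟩)
      rwa [adj, Equiv.swap_apply_left, Equiv.swap_apply_right]
    · rw [Finset.mem_map]
      rintro ⟨⟨a, b⟩, hq, he⟩
      rw [Finset.mem_filter] at hq
      have ha : adj i h a = ⟨i, by omega⟩ := congrArg Prod.fst he
      have hb : adj i h b = ⟨i + 1, h⟩ := congrArg Prod.snd he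
      have hlt : (a : ℕ) < b := hq.2.1
      rw [← hs a, ← hs b, ha, hb, adj, Equiv.swap_apply_left, Equiv.swap_apply_right] at hlt
      simp only at hlt
      omega
  · intro p hp
    obtain ⟨q, hq, rfl⟩ := Finset.mem_map.1 hp
    obtain ⟨a, b⟩ := q
    simp only [Finset.mem_filter, Finset.mem_univ, true_and] at hq
    have hne : ¬ ((a : ℕ) = i ∧ (b : ℕ) = i + 1) := by
      rintro ⟨ha, hb⟩
      have ea : (⟨i, by omega⟩ : Fin n) = a := Fin.ext ha.symm
      have eb : (⟨i + 1, h⟩ : Fin n) = b := Fin.ext hb.symm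
      rw [ea, eb] at hv
      exact hv.asymm hq.2
    have hab : (a : ℕ) < b := hq.1
    have key : adj i h a < adj i h b := by
      rw [Fin.lt_def, adj_apply_val, adj_apply_val]
      simp only [Equiv.swap_apply_def]
      split_ifs <;> omega
    simp only [Finset.mem_filter, Finset.mem_univ, true_and]
    refine ⟨key, ?_⟩
    change v (adj i h (adj i h b)) < v (adj i h (adj i h a))
    rw [hs, hs]
    exact hq.2

lemma w0_apply_val (i : Fin n) : (w0 n i : ℕ) = n - 1 - i := by
  simp [w0, Fin.val_rev]
  omega

/-- Every permutation is obtained from `w₀` by inserting its values, in increasing order, into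
decreasing initial segments; each insertion only passes through descents. -/
lemma insertion_induction (M : ℕ → ℕ → Perm' n → Prop)
    (base : M (n - 1) (n - 1) (w0 n))
    (step : ∀ (j m : ℕ) (hm : m + 1 < n) (v : Perm' n), j ≤ m →
      v ⟨m, by omega⟩ < v ⟨m + 1, hm⟩ → M j m (v * adj m hm) → M j (m + 1) v)
    (shift : ∀ (j m : ℕ) (hm : m < n) (v : Perm' n), j + 1 ≤ m →
      (v ⟨m, hm⟩ : ℕ) = n - 1 - (j + 1) → (∀ i : Fin n, (i : ℕ) ≤ j → (v i : ℕ) = n - 1 - i) →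
      M (j + 1) m v → M j j v)
    (r j m : ℕ) (hm : m < n) (v : Perm' n) (hr : j + r = n - 1) (hjm : j ≤ m)
    (hv : ∀ i : Fin n, (i : ℕ) < j → (v i : ℕ) = n - 1 - i)
    (hvm : (v ⟨m, hm⟩ : ℕ) = n - 1 - j) : M j m v := by
  induction r generalizing j m v with
  | zero =>
    obtain rfl : j = n - 1 := by omega
    obtain rfl : m = n - 1 := by omega
    convert base
    ext i
    rw [w0_apply_val]
    rcases (show (i : ℕ) < n - 1 ∨ (i : ℕ) = n - 1 by omega) with h | h
    · exact hv i h
    · obtain rfl : i = ⟨n - 1, hm⟩ := Fin.ext h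
      exact hvm
  | succ r ihr =>
    obtain ⟨p, rfl⟩ := Nat.exists_eq_add_of_le hjm
    induction p generalizing v with
    | zero =>
      have hv' (i : Fin n) (hi : (i : ℕ) ≤ j) : (v i : ℕ) = n - 1 - i := by
        rcases hi.lt_or_eq with h | h
        · exact hv i h
        · obtain rfl : i = ⟨j, hm⟩ := Fin.ext h
          exact hvm
      let k := v.symm ⟨n - 1 - (j + 1), by omega⟩
      have hk : (v k : ℕ) = n - 1 - (j + 1) := by simp [k]
      have hjk : j + 1 ≤ k := by
        by_contra hlt
        have := hv' k (by omega)
        omega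
      exact shift j k k.2 v hjk hk hv' (ihr (j + 1) k k.2 v (by omega) hjk
        (fun i hi => hv' i (by omega)) hk)
    | succ p ihp =>
      have hm' : j + p + 1 < n := hm
      have hlt : v ⟨j + p, by omega⟩ < v ⟨j + p + 1, hm'⟩ := by
        have hvm' : (v ⟨j + p + 1, hm'⟩ : ℕ) = n - 1 - j := hvm
        by_contra hge
        have hge' : n - 1 - j ≤ (v ⟨j + p, by omega⟩ : ℕ) := by
          rw [← hvm']
          exact not_lt.1 hge
        have hb := (v ⟨j + p, by omega⟩).2
        have hu := hvm'
        rcases hge'.eq_or_lt with he | hl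
        · have := v.injective (Fin.ext (hvm'.trans he))
          simp [Fin.ext_iff] at this
        · have hi := hv ⟨n - 1 - v ⟨j + p, by omega⟩, by omega⟩ (by simp only; omega)
          have := v.injective (Fin.ext (hi.trans (show _ = (v ⟨j + p, by omega⟩ : ℕ) by
            simp only; omega)))
          simp only [Fin.ext_iff] at this
          omega
      refine step j (j + p) hm' v (by omega) hlt
        (ihp (v := v * adj (j + p) hm') ?_ (by omega) (by omega) ?_)
      · intro i hi
        rw [Equiv.Perm.mul_apply, adj, Equiv.swap_apply_of_ne_of_ne]
        · exact hv i hi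
        · simp only [ne_eq, Fin.ext_iff]; omega
        · simp only [ne_eq, Fin.ext_iff]; omega
      · rw [Equiv.Perm.mul_apply, adj, Equiv.swap_apply_left]
        exact hvm

end Permutations
/-- The form of `insertion_induction` that reaches every permutation. -/
lemma exists_insertion {n : ℕ} (hn : 0 < n) (M : ℕ → ℕ → Perm' n → Prop)
    (base : M (n - 1) (n - 1) (w0 n))
    (step : ∀ (j m : ℕ) (hm : m + 1 < n) (v : Perm' n), j ≤ m →
      v ⟨m, by omega⟩ < v ⟨m + 1, hm⟩ → M j m (v * adj m hm) → M j (m + 1) v)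
    (shift : ∀ (j m : ℕ) (v : Perm' n), M (j + 1) m v → M j j v) (v : Perm' n) :
    ∃ m, M 0 m v :=
  ⟨v.symm ⟨n - 1, by omega⟩, insertion_induction M base step
    (fun j m _ v _ _ _ h => shift j m v h) (n - 1) 0 _ (Fin.is_lt _) v (zero_add _)
    (Nat.zero_le _) (fun _ h => absurd h (Nat.not_lt_zero _)) (by simp)⟩

lemma invLength_le {n : ℕ} (v : Perm' n) : invLength v ≤ ∑ k ∈ Finset.range n, k := by
  rw [← Fin.sum_univ_eq_sum_range (fun k => k), invLength, Finset.card_filter,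
    Fintype.sum_prod_type_right]
  refine Finset.sum_le_sum fun b _ => ?_
  rw [← Finset.card_filter]
  refine (Finset.card_le_card (t := Finset.Iio b) fun a ha => ?_).trans (Fin.card_Iio b).le
  exact Finset.mem_Iio.2 (Finset.mem_filter.1 ha).2.1

lemma eq_one_of_invLength_eq_zero {n : ℕ} {v : Perm' n} (hv : invLength v = 0) : v = 1 := by
  have hm : StrictMono v := by
    intro a b hab
    by_contra hlt
    have := Finset.filter_eq_empty_iff.1 (Finset.card_eq_zero.1 hv) (Finset.mem_univ (a, b))
    exact this ⟨hab, lt_of_le_of_ne (not_lt.1 hlt) (v.injective.ne hab.ne')⟩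
  exact DFunLike.coe_injective ((hm.range_inj strictMono_id).1 (by simp))

section Schubert

variable {n : ℕ} {R : Type*} [CommRing R]

/-- The inclusion of `ℤ[x₁, …, xₙ]` into the polynomials in infinitely many variables over `R`. -/
def incl (n : ℕ) (R : Type*) [CommRing R] : MvPolynomial (Fin n) ℤ →ₐ[ℤ] MvPolynomial ℕ R :=
  aeval fun i => X (i : ℕ)

lemma swapHom_incl (i : ℕ) (h : i + 1 < n) (f : MvPolynomial (Fin n) ℤ) :
    swapHom R i (incl n R f) = incl n R (rename (adj i h) f) := by
  induction f using MvPolynomial.induction_on with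
  | C a => simp [incl]
  | add p q hp hq => simp only [map_add, hp, hq]
  | mul_X p k hp =>
    simp only [map_mul, hp, rename_X]
    simp [incl, swapHom, adj_apply_val]

lemma incl_xDelta (hn : 0 < n) : incl n R (xDelta n) = staircase R (n - 1) := by
  rw [staircase, Nat.sub_add_cancel hn, ← Fin.prod_univ_eq_prod_range (fun k => X k ^ (n - 1 - k))]
  simp [xDelta, incl]

variable [IsDomain R] {S : Perm' n → MvPolynomial (Fin n) ℤ}

lemma divDiff_schubert (hS : IsSchubertFamily n S) (v : Perm' n) (i : ℕ) (h : i + 1 < n)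
    (hv : v ⟨i, by omega⟩ < v ⟨i + 1, h⟩) :
    divDiff R i (incl n R (S (v * adj i h))) = incl n R (S v) := by
  have key := hS.2 (v * adj i h) i h
    (by rw [mul_assoc, Equiv.swap_mul_self, mul_one]; exact invLength_lt_mul_adj v i h hv)
  rw [mul_assoc, Equiv.swap_mul_self, mul_one] at key
  refine divDiff_unique ?_
  rw [swapHom_incl i h, ← map_sub, key]
  simp [incl]

lemma schubert_mem_augIdeal_pow (hn : 0 < n) (hS : IsSchubertFamily n S) (v : Perm' n) :
    incl n R (S v) ∈ augIdeal R ^ invLength v := by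
  refine (exists_insertion hn (fun _ _ v => incl n R (S v) ∈ augIdeal R ^ invLength v) ?_ ?_
    (fun _ _ _ h => h) v).elim fun _ h => h
  · rw [hS.1, incl_xDelta hn]
    refine Ideal.pow_le_pow_right ?_ (staircase_mem_augIdeal_pow (n - 1))
    rw [Nat.sub_add_cancel hn]
    exact invLength_le _
  · intro _ m hm v _ hlt h
    rw [← divDiff_schubert hS v m hm hlt]
    exact divDiff_mem_augIdeal_pow _ _
      (Ideal.pow_le_pow_right (invLength_lt_mul_adj v m hm hlt) h)

lemma schubert_one (hn : 0 < n) (hS : IsSchubertFamily n S) : incl n R (S 1) = 1 := by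
  have := insertion_induction (fun j m v =>
    (∀ i i' : Fin n, i < i' → j ≤ i → (i : ℕ) ≠ m → (i' : ℕ) ≠ m → v i < v i') →
      incl n R (S v) = (∏ i ∈ Finset.range j, X i ^ (n - 1 - i)) *
        rowDown R (m - j) j (X j ^ (n - 1 - j))) ?_ ?_ ?_ (n - 1) 0 (n - 1) (by omega) 1
    (zero_add _) (Nat.zero_le _) (fun _ h => absurd h (Nat.not_lt_zero _)) rfl
    (fun i i' h _ _ _ => h)
  · rw [this]
    simp [rowDown_X_pow]
  · intro _
    rw [hS.1, incl_xDelta hn, staircase, Finset.prod_range_succ, Nat.sub_self (n - 1)]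
    rfl
  · intro j m hm v hjm hlt ih hv
    have hsymm : swapHom R m (∏ i ∈ Finset.range j, X i ^ (n - 1 - i)) =
        ∏ i ∈ Finset.range j, X i ^ (n - 1 - i) := by
      rw [map_prod]
      refine Finset.prod_congr rfl fun i hi => ?_
      have := Finset.mem_range.1 hi
      rw [map_pow, swapHom_X_of_ne (by omega) (by omega)]
    rw [← divDiff_schubert hS v m hm hlt, ih, divDiff_symm_mul hsymm,
      show m + 1 - j = m - j + 1 by omega, rowDown_succ', Nat.add_sub_cancel' hjm]
    intro i i' hii hj hi hi'
    have h1 := adj_apply_val m hm i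
    have h2 := adj_apply_val m hm i'
    have hii' : (i : ℕ) < i' := hii
    change v (adj m hm i) < v (adj m hm i')
    generalize adj m hm i = a at h1 ⊢
    generalize adj m hm i' = b at h2 ⊢
    simp only [Equiv.swap_apply_def] at h1 h2
    refine hv a b ?_ ?_ ?_ ?_
    · rw [Fin.lt_def]
      split_ifs at h1 h2 <;> omega
    all_goals split_ifs at h1 h2 <;> omega
  · intro j m hm v hjm hvm hvi ih hv
    obtain rfl : m = n - 1 := by
      by_contra hne
      have hlt := Fin.lt_def.1 (hv ⟨m, hm⟩ ⟨n - 1, by omega⟩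
        (Fin.lt_def.2 (by simp only; omega)) (by simp only; omega) (by simp only; omega)
        (by simp only; omega))
      have hb := (v ⟨n - 1, by omega⟩).2
      have hi := hvi ⟨n - 1 - v ⟨n - 1, by omega⟩, by omega⟩ (by simp only; omega)
      have := congrArg Fin.val (v.injective (Fin.ext (hi.trans
        (show _ = (v ⟨n - 1, by omega⟩ : ℕ) by simp only; omega))))
      simp only at this
      omega
    rw [ih fun i i' hii hj hi hi' => hv i i' hii (by omega) (by omega)
      (by rw [Fin.lt_def] at hii; omega), rowDown_X_pow le_rfl, if_pos rfl, mul_one,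
      Finset.prod_range_succ, Nat.sub_self j]
    rfl

lemma constantCoeff_schubert_mem (hn : 0 < n) (hS : IsSchubertFamily n S) (P : Subsemiring R)
    (v : Perm' n) : constantCoeff (incl n R (S v)) ∈ P := by
  by_cases hv : invLength v = 0
  · rw [eq_one_of_invLength_eq_zero hv, schubert_one hn hS, map_one]
    exact P.one_mem
  · rw [(RingHom.mem_ker).1 (Ideal.pow_le_self hv (schubert_mem_augIdeal_pow (R := R) hn hS v))]
    exact P.zero_mem

/-- The pairings of `f` with all Schubert polynomials lie in `P`. -/
def PairsInto (S : Perm' n → MvPolynomial (Fin n) ℤ) (P : Subsemiring R)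
    (f : MvPolynomial ℕ R) : Prop :=
  ∀ v, constantCoeff (longDiff R (n - 1) 0 (f * incl n R (S v))) ∈ P

variable {P : Subsemiring R}

lemma constantCoeff_longDiff_mul_w0 (hn : 0 < n) (hS : IsSchubertFamily n S)
    (f : MvPolynomial ℕ R) :
    constantCoeff (longDiff R (n - 1) 0 (f * incl n R (S (w0 n)))) = constantCoeff f := by
  rw [hS.1, incl_xDelta hn, constantCoeff_longDiff_staircase]

lemma longDiff_mul_schubert (hS : IsSchubertFamily n S) (v : Perm' n) (i : ℕ) (h : i + 1 < n)
    (hv : v ⟨i, by omega⟩ < v ⟨i + 1, h⟩) (f : MvPolynomial ℕ R) :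
    longDiff R (n - 1) 0 (f * incl n R (S v)) =
      longDiff R (n - 1) 0 (divDiff R i f * incl n R (S (v * adj i h))) := by
  rw [longDiff_divDiff_mul (Nat.zero_le _) (by omega), divDiff_schubert hS v i h hv]

lemma PairsInto.divDiff (hS : IsSchubertFamily n S) {f : MvPolynomial ℕ R}
    (hf : PairsInto S P f) (i : ℕ) (h : i + 1 < n) : PairsInto S P (divDiff R i f) := by
  intro v
  rcases lt_or_gt_of_ne (v.injective.ne (show (⟨i, by omega⟩ : Fin n) ≠ ⟨i + 1, h⟩ by simp)) with
    hv | hv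
  · rw [longDiff_divDiff_mul (Nat.zero_le _) (by omega), ← divDiff_schubert hS v i h hv,
      divDiff_divDiff, mul_zero, map_zero, map_zero]
    exact P.zero_mem
  · have key := longDiff_mul_schubert hS (v * adj i h) i h
      (by simpa [Equiv.Perm.mul_apply] using hv) f
    rw [mul_assoc, Equiv.swap_mul_self, mul_one] at key
    rw [← key]
    exact hf _

lemma pairsInto_schubert (hn : 0 < n) (hS : IsSchubertFamily n S) (u : Perm' n) :
    PairsInto S P (incl n R (S u)) := by
  refine (exists_insertion hn (fun _ _ u => PairsInto S P (incl n R (S u))) ?_ ?_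
    (fun _ _ _ h => h) u).elim fun _ h => h
  · intro v
    rw [hS.1, mul_comm, incl_xDelta hn, constantCoeff_longDiff_staircase]
    exact constantCoeff_schubert_mem hn hS P v
  · intro _ m hm v _ hlt h
    rw [← divDiff_schubert hS v m hm hlt]
    exact h.divDiff hS m hm

lemma PairsInto.mul_rootProd (hn : 0 < n) (hS : IsSchubertFamily n S) {f : MvPolynomial ℕ R}
    (hf : PairsInto S P f) {c : R} (hc : c ∈ P) {A : Finset ℕ}
    (hA : ∀ i i', i < i' → i' < n → i ∈ A → i' ∈ A) : PairsInto S P (f * rootProd c A) := by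
  intro v
  refine (exists_insertion hn (fun j m v => ∀ f : MvPolynomial ℕ R, PairsInto S P f →
    ∀ A : Finset ℕ, (∀ i i', j ≤ i → i < i' → i' < n → i ≠ m → i ∈ A → i' ∈ A) →
      constantCoeff (longDiff R (n - 1) 0 (f * rootProd c A * incl n R (S v))) ∈ P) ?_ ?_ ?_ v).elim
    fun _ h => h f hf A fun i i' _ h1 h2 _ => hA i i' h1 h2
  · intro f hf A _
    rw [constantCoeff_longDiff_mul_w0 hn hS, map_mul]
    refine P.mul_mem ?_ ?_
    · rw [← constantCoeff_longDiff_mul_w0 hn hS]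
      exact hf _
    · rw [rootProd, map_prod]
      exact P.prod_mem fun l _ => by simpa using hc
  · intro j m hm v hjm hlt ih f hf A hA
    rw [longDiff_mul_schubert hS v m hm hlt]
    by_cases hAm : m ∈ A ↔ m + 1 ∈ A
    · rw [mul_comm f, divDiff_symm_mul (swapHom_rootProd hAm), mul_comm (rootProd c A)]
      refine ih _ (hf.divDiff hS m hm) A fun i i' hi hii hi' hne hiA => ?_
      by_cases him : i = m + 1
      · exact hA m i' hjm (by omega) hi' (by omega) (hAm.2 (him ▸ hiA))
      · exact hA i i' hi hii hi' him hiA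
    · have hmA : m ∉ A := fun hmem =>
        hAm (iff_of_true hmem (hA m (m + 1) hjm (by omega) hm (by omega) hmem))
      have hmA' : m + 1 ∈ A := by tauto
      have hB : ∀ i i', j ≤ i → i < i' → i' < n → i ∈ A.erase (m + 1) → i ≠ m →
          i' ∈ A.erase (m + 1) := by
        intro i i' hi hii hi' hiB hne
        obtain ⟨him, hiA⟩ := Finset.mem_erase.1 hiB
        refine Finset.mem_erase.2 ⟨?_, hA i i' hi hii hi' him hiA⟩
        rintro rfl
        exact hmA (hA i m hi (by omega) (by omega) him hiA)
      have hmB : m ∉ A.erase (m + 1) := fun h => hmA (Finset.mem_of_mem_erase h)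
      have hsymm : swapHom R m (rootProd c (A.erase (m + 1))) = rootProd c (A.erase (m + 1)) :=
        swapHom_rootProd (iff_of_false hmB (Finset.notMem_erase _ _))
      have hins : rootProd c (insert m (A.erase (m + 1))) =
          (C c - X m) * rootProd c (A.erase (m + 1)) := Finset.prod_insert hmB
      have herase : rootProd c A = (C c - X (m + 1)) * rootProd c (A.erase (m + 1)) :=
        (Finset.mul_prod_erase A (fun l => (C c - X l : MvPolynomial ℕ R)) hmA').symm
      have key : SkewSchubert.divDiff R m (f * rootProd c A) =
          SkewSchubert.divDiff R m f * rootProd c (insert m (A.erase (m + 1))) +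
            f * rootProd c (A.erase (m + 1)) := by
        rw [herase, hins, ← mul_assoc f, mul_comm _ (rootProd c _), divDiff_symm_mul hsymm,
          divDiff_mul, divDiff_C_sub_X, map_sub, swapHom_C, swapHom_X_right]
        ring
      rw [key, add_mul, map_add, map_add]
      refine P.add_mem (ih _ (hf.divDiff hS m hm) _ ?_) (ih _ hf _ ?_)
      · intro i i' hi hii hi' hne hiB
        exact Finset.mem_insert_of_mem
          (hB i i' hi hii hi' ((Finset.mem_insert.1 hiB).resolve_left hne) hne)
      · intro i i' hi hii hi' hne hiB
        exact hB i i' hi hii hi' hiB hne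
  · intro j m v ih f hf A hA
    exact ih f hf A fun i i' hi hii hi' _ => hA i i' (by omega) hii hi' (by omega)

lemma PairsInto.mul_kernel (hn : 0 < n) (hS : IsSchubertFamily n S) {f : MvPolynomial ℕ R}
    (hf : PairsInto S P f) {c : ℕ → R} (hc : ∀ k, c k ∈ P) (s : Finset ℕ) :
    PairsInto S P (f * ∏ k ∈ s, rootProd (c k) (Finset.Ioc k (n - 1))) := by
  induction s using Finset.induction_on with
  | empty => simpa using hf
  | insert k s hk ih =>
    rw [Finset.prod_insert hk, mul_comm (rootProd _ _), ← mul_assoc]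
    refine ih.mul_rootProd hn hS (hc k) fun i i' hii hi' hi => ?_
    rw [Finset.mem_Ioc] at hi ⊢
    omega

lemma constantCoeff_longDiff_incl_mul_kernel (hn : 0 < n) (c : ℕ → R)
    {f : MvPolynomial (Fin n) ℤ} (hf : ∀ d ∈ f.support, ∀ i : Fin n, d i ≤ n - 1 - (i : ℕ)) :
    constantCoeff (longDiff R (n - 1) 0 (incl n R f *
      ∏ k ∈ Finset.range n, rootProd (c k) (Finset.Ioc k (n - 1)))) =
        eval₂ (Int.castRingHom R) (fun i : Fin n => c i) f := by
  rw [incl, aeval_def, eval₂_eq', eval₂_eq', Finset.sum_mul, map_sum, map_sum]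
  refine Finset.sum_congr rfl fun d hd => ?_
  rw [mul_assoc, ← Algebra.smul_def, eq_intCast, ← zsmul_eq_mul, map_zsmul, map_zsmul]
  congr 1
  let d' : ℕ → ℕ := fun k => if h : k < n then d ⟨k, h⟩ else 0
  have hd' (i : Fin n) : d i = d' i := by simp [d']
  have hI : Finset.Icc 0 (n - 1) = Finset.range n := by
    rw [← Nat.range_succ_eq_Icc_zero, Nat.sub_add_cancel hn]
  have key := longDiff_mul_kernel c d' (n - 1) 0 (by
    intro k hk
    rw [zero_add, hI, Finset.mem_range] at hk
    have := hf d hd ⟨k, hk⟩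
    rw [hd'] at this
    simp only at this
    omega)
  simp only [zero_add, hI, Finset.prod_mul_distrib] at key
  simp only [hd']
  rw [Fin.prod_univ_eq_prod_range (fun k => (X k : MvPolynomial ℕ R) ^ d' k), key, constantCoeff_C,
    Fin.prod_univ_eq_prod_range (fun k => c k ^ d' k)]

lemma constantCoeff_longDiff_symIdeal {f : MvPolynomial (Fin n) ℤ} (hf : f ∈ symIdeal n)
    (g : MvPolynomial ℕ R) :
    constantCoeff (longDiff R (n - 1) 0 (incl n R f * g)) = 0 := by
  induction hf using Submodule.span_induction generalizing g with
  | mem f hf =>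
    obtain ⟨k, hk, rfl⟩ := hf
    have hk0 : k ≠ 0 := by have := hk.1; omega
    rw [longDiff_symm_mul, map_mul]
    · have : constantCoeff (incl n R (esymm (Fin n) ℤ k)) = 0 := by
        rw [esymm, map_sum, map_sum]
        refine Finset.sum_eq_zero fun s hs => ?_
        rw [Finset.mem_powersetCard] at hs
        simp [incl, hs.2, hk0]
      rw [this, zero_mul]
    · intro i _ hi
      rw [swapHom_incl i (by omega), esymm_isSymmetric]
  | zero => simp
  | add x y _ _ hx hy => rw [map_add, add_mul, map_add, map_add, hx, hy, add_zero]
  | smul a x _ hx => rw [smul_eq_mul, mul_comm a, map_mul (incl n R), mul_assoc, hx]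

end Schubert

/-- The semiring of polynomials with nonnegative coefficients. -/
def nonnegCoeffs (σ : Type*) : Subsemiring (MvPolynomial σ ℤ) where
  carrier := {f | ∀ d, 0 ≤ coeff d f}
  mul_mem' {f g} hf hg d := by
    classical
    rw [coeff_mul]
    exact Finset.sum_nonneg fun x _ => mul_nonneg (hf _) (hg _)
  one_mem' d := by
    classical
    rw [coeff_one]
    split_ifs <;> simp
  add_mem' {f g} hf hg d := by
    rw [coeff_add]
    exact add_nonneg (hf d) (hg d)
  zero_mem' d := by simp

lemma X_mem_nonnegCoeffs {σ : Type*} (i : σ) : X i ∈ nonnegCoeffs σ := fun d => by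
  classical
  rw [coeff_X]
  split_ifs <;> simp

theorem normalForm_mem_nonnegCoeffs {n : ℕ} {S : Perm' n → MvPolynomial (Fin n) ℤ}
    (hS : IsSchubertFamily n S) {u v : Perm' n} {f : MvPolynomial (Fin n) ℤ}
    (hf : IsNormalForm n (S u * S v) f) : f ∈ nonnegCoeffs (Fin n) := by
  rcases Nat.eq_zero_or_pos n with rfl | hn
  · have hS1 (v : Perm' 0) : S v = 1 := by
      rw [Subsingleton.elim v (w0 0), hS.1]
      simp [xDelta]
    have h := hf.1
    rw [hS1, hS1, mul_one, symIdeal, Set.Icc_eq_empty (by simp), Set.image_empty, Ideal.span_empty,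
      Ideal.mem_bot, sub_eq_zero] at h
    rw [← h]
    exact Subsemiring.one_mem _
  · let c : ℕ → MvPolynomial (Fin n) ℤ := fun k => if h : k < n then X ⟨k, h⟩ else 0
    have hc (k : ℕ) : c k ∈ nonnegCoeffs (Fin n) := by
      simp only [c]
      split_ifs
      · exact X_mem_nonnegCoeffs _
      · exact Subsemiring.zero_mem _
    have h1 := constantCoeff_longDiff_incl_mul_kernel hn c hf.2
    have h2 := constantCoeff_longDiff_symIdeal hf.1
      (∏ k ∈ Finset.range n, rootProd (c k) (Finset.Ioc k (n - 1)))
    have hX : (fun i : Fin n => c i) = X := by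
      funext i
      simp [c]
    rw [hX, Subsingleton.elim (Int.castRingHom _) C, eval₂_eta] at h1
    rw [map_sub, sub_mul, map_sub, map_sub, h1, sub_eq_zero, map_mul (incl n _),
      mul_right_comm] at h2
    rw [← h2]
    exact (pairsInto_schubert hn hS u).mul_kernel hn hS hc _ v

end SkewSchubert

/-- For `u ≤ w` in Bruhat order, every coefficient of the skew
Schubert polynomial `S_{w/u}` is a nonnegative integer. -/
theorem skew_schubert_coeff_nonneg (n : ℕ)
    (S : Perm' n → MvPolynomial (Fin n) ℤ) (hS : IsSchubertFamily n S)
    (u w : Perm' n) (huw : BruhatLE u w)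
    (skw : MvPolynomial (Fin n) ℤ)
    (hskw : IsNormalForm n (S u * S (w0 n * w)) skw) :
    ∀ d : Fin n →₀ ℕ, 0 ≤ MvPolynomial.coeff d skw :=
  SkewSchubert.normalForm_mem_nonnegCoeffs hS hskw
end
end
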